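/- arXiv:1110.5770 — 4 statements merged into one kernel-verified Lean document; each statement's English description precedes it below -/
import Mathlib

section
/- Every 2-connected graph G of order n ≥ 3 satisfies rvc(G) ≤ ⌈n/2⌉. -/
/-- The list of internal vertices of a walk (its support minus the two ends). -/
def SimpleGraph.Walk.internalVertices {V : Type*} {G : SimpleGraph V} {u v : V}
    (p : G.Walk u v) : List V :=
  p.support.tail.dropLast

/-- A walk is a *rainbow path* w.r.t. a vertex coloring `c` if it is a path and its
internal vertices receive pairwise distinct colors. -/
def SimpleGraph.Walk.IsRainbowPath {V α : Type*} {G : SimpleGraph V} {u v : V}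
    (c : V → α) (p : G.Walk u v) : Prop :=
  p.IsPath ∧ (p.internalVertices.map c).Nodup

/-- A vertex-colored graph is *rainbow vertex-connected* if every pair of distinct
vertices is joined by at least one rainbow path. -/
def SimpleGraph.RainbowVertexConnected {V α : Type*} (G : SimpleGraph V) (c : V → α) : Prop :=
  ∀ u v : V, u ≠ v → ∃ p : G.Walk u v, p.IsRainbowPath c

/-- `G` can be made rainbow vertex-connected using at most `k` colors: there is a
vertex coloring such that every pair of distinct vertices is joined by a rainbow path
all of whose internal vertices have colors among `0, …, k-1`. -/
def SimpleGraph.RVCWith {V : Type*} (G : SimpleGraph V) (k : ℕ) : Prop :=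
  ∃ c : V → ℕ, ∀ u v : V, u ≠ v → ∃ p : G.Walk u v,
    p.IsRainbowPath c ∧ ∀ w ∈ p.internalVertices, c w < k

/-- The *rainbow vertex-connection number* `rvc G`: the minimum number of colors
needed to make `G` rainbow vertex-connected. -/
noncomputable def SimpleGraph.rvc {V : Type*} (G : SimpleGraph V) : ℕ :=
  sInf {k | G.RVCWith k}

/-- A walk is a *revised rainbow path* w.r.t. a vertex coloring `c` if it is a path and
all of its vertices have distinct colors except that the two end vertices may share a
color. -/
def SimpleGraph.Walk.IsRevisedRainbowPath {V α : Type*} {G : SimpleGraph V} {u v : V}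
    (c : V → α) (p : G.Walk u v) : Prop :=
  p.IsPath ∧ (p.support.dropLast.map c).Nodup ∧ (p.support.tail.map c).Nodup

/-- A vertex-colored graph is *revised rainbow vertex-connected* if every pair of
distinct vertices is joined by at least one revised rainbow path. -/
def SimpleGraph.RevisedRainbowVertexConnected {V α : Type*} (G : SimpleGraph V)
    (c : V → α) : Prop :=
  ∀ u v : V, u ≠ v → ∃ p : G.Walk u v, p.IsRevisedRainbowPath c

/-- The *revised rainbow vertex-connection number* `rvc* G`. -/
noncomputable def SimpleGraph.rvcStar {V : Type*} (G : SimpleGraph V) : ℕ :=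
  sInf {k | ∃ c : V → Fin k, G.RevisedRainbowVertexConnected c}

/-- A *cut vertex*: a vertex whose removal disconnects the graph. -/
def SimpleGraph.IsCutVertex {V : Type*} (G : SimpleGraph V) (v : V) : Prop :=
  ¬ (G.induce {u | u ≠ v}).Preconnected

/-- A *block* of `G`: a maximal (induced) connected subgraph without a cut vertex,
described by its vertex set. -/
def SimpleGraph.IsBlock {V : Type*} (G : SimpleGraph V) (B : Set V) : Prop :=
  (G.induce B).Connected ∧ (∀ v, ¬ (G.induce B).IsCutVertex v) ∧
    ∀ C : Set V, B ⊆ C → (G.induce C).Connected →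
      (∀ v, ¬ (G.induce C).IsCutVertex v) → C = B

/-- Reachability inside the finite set `S`. -/
def RS {V : Type*} (G : SimpleGraph V) (S : Finset V) (x y : V) : Prop :=
  Relation.ReflTransGen (fun a b => G.Adj a b ∧ a ∈ S ∧ b ∈ S) x y

/-- `S` is connected in `G`. -/
def CS {V : Type*} (G : SimpleGraph V) (S : Finset V) : Prop :=
  ∀ x ∈ S, ∀ y ∈ S, RS G S x y

/-- After deleting any `x ∈ S`, every vertex of `S` still reaches `T`. -/
def OneSide {V : Type*} [DecidableEq V] (G : SimpleGraph V) (S T : Finset V)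
    (Y : V → V → Prop) : Prop :=
  ∀ x ∈ S, ∀ y ∈ S, y ≠ x → ∃ z ∈ S, z ≠ x ∧ RS G (S.erase x) y z ∧ ∃ a ∈ T, Y z a

theorem RS.mono {V : Type*} {G : SimpleGraph V} {S T : Finset V} (h : S ⊆ T) {x y : V}
    (hr : RS G S x y) : RS G T x y := by
  unfold RS at *
  induction hr with
  | refl => exact .refl
  | tail _ hab ih => exact .tail ih ⟨hab.1, h hab.2.1, h hab.2.2⟩

theorem RS.symm {V : Type*} {G : SimpleGraph V} {S : Finset V} {x y : V}
    (hr : RS G S x y) : RS G S y x := by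
  unfold RS at *
  induction hr with
  | refl => exact .refl
  | tail _ h ih => exact .head ⟨h.1.symm, h.2.2, h.2.1⟩ ih

theorem RS.trans {V : Type*} {G : SimpleGraph V} {S : Finset V} {x y z : V}
    (h1 : RS G S x y) (h2 : RS G S y z) : RS G S x z :=
  Relation.ReflTransGen.trans h1 h2

theorem RS.mem {V : Type*} {G : SimpleGraph V} {S : Finset V} {x y : V}
    (hr : RS G S x y) (hx : x ∈ S) : y ∈ S := by
  unfold RS at hr
  induction hr with
  | refl => exact hx
  | tail _ h ih => exact h.2.2

/-- Either `w` is avoided or it is reached through a neighbour. -/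
theorem RS.split {V : Type*} [DecidableEq V] {G : SimpleGraph V} {S : Finset V} {x y w : V}
    (hr : RS G S x y) (hxw : x ≠ w) :
    (y ≠ w ∧ RS G (S.erase w) x y) ∨ ∃ p, RS G (S.erase w) x p ∧ p ≠ w ∧ p ∈ S ∧ G.Adj p w := by
  unfold RS at hr
  induction hr with
  | refl => exact Or.inl ⟨hxw, .refl⟩
  | @tail b c _ h ih =>
    rcases ih with ⟨hb, ih⟩ | ih
    · by_cases hc : c = w
      · subst hc
        exact Or.inr ⟨b, ih, hb, h.2.1, h.1⟩
      · exact Or.inl ⟨hc, Relation.ReflTransGen.tail ih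
          ⟨h.1, Finset.mem_erase.2 ⟨hb, h.2.1⟩, Finset.mem_erase.2 ⟨hc, h.2.2⟩⟩⟩
    · exact Or.inr ih

theorem CS.exists_adj {V : Type*} {G : SimpleGraph V} {S : Finset V} (h : CS G S)
    (hc : 2 ≤ S.card) {x : V} (hx : x ∈ S) : ∃ y ∈ S, G.Adj x y := by
  obtain ⟨y, hy, hyx⟩ := Finset.exists_mem_ne (by omega : 1 < S.card) x
  rcases (Relation.ReflTransGen.cases_head (h x hx y hy)) with e | ⟨z, hz, _⟩
  · exact absurd e.symm hyx
  · exact ⟨z, hz.2.2, hz.1⟩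

/-- Candidate lemma: a non-cut vertex of `S`, different from `x`, with a neighbour in `T`. -/
theorem candidate {V : Type*} [DecidableEq V] {G : SimpleGraph V} {S T : Finset V}
    {Y : V → V → Prop} (hS : CS G S) (h1 : OneSide G S T Y) (hc : 2 ≤ S.card)
    {x : V} (hx : x ∈ S) :
    ∃ w ∈ S, w ≠ x ∧ CS G (S.erase w) ∧ ∃ a ∈ T, Y w a := by
  classical
  let C : V → Finset V := fun w => S.filter (fun z => RS G (S.erase w) x z)
  let K : Finset V := S.filter (fun w => w ≠ x ∧ ∃ a ∈ T, Y w a)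
  have hK : K.Nonempty := by
    obtain ⟨y, hy, hyx⟩ := Finset.exists_mem_ne (by omega : 1 < S.card) x
    obtain ⟨z, hz, hzx, _, ha⟩ := h1 x hx y hy hyx
    exact ⟨z, Finset.mem_filter.2 ⟨hz, hzx, ha⟩⟩
  obtain ⟨w, hwK, hmax⟩ := Finset.exists_max_image K (fun w => (C w).card) hK
  obtain ⟨hwS, hwx, hwa⟩ := Finset.mem_filter.1 hwK
  refine ⟨w, hwS, hwx, ?_, hwa⟩
  have key : ∀ y ∈ S, y ≠ w → RS G (S.erase w) x y := by
    intro y hy hyw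
    by_contra hno
    obtain ⟨z, hz, hzw, hyz, hza⟩ := h1 w hwS y hy hyw
    have hxz : ¬ RS G (S.erase w) x z := fun h => hno (h.trans hyz.symm)
    have hzx : z ≠ x := fun e => hxz (e ▸ Relation.ReflTransGen.refl)
    have hzK : z ∈ K := Finset.mem_filter.2 ⟨hz, hzx, hza⟩
    have hsub : ∀ v, RS G (S.erase w) x v → RS G (S.erase z) x v := by
      intro v hv
      rcases RS.split hv hzx.symm with ⟨_, h⟩ | ⟨p, hp, hpz, hpS, hadj⟩
      · exact h.mono (by intro t; simp only [Finset.mem_erase]; tauto)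
      · exfalso
        apply hxz
        have : RS G (S.erase w) x p :=
          hp.mono (by intro t; simp only [Finset.mem_erase]; tauto)
        exact Relation.ReflTransGen.tail this ⟨hadj, hpS, Finset.mem_erase.2 ⟨hzw, hz⟩⟩
    have hw : RS G (S.erase z) x w := by
      rcases RS.split (hS x hx w hwS) hwx.symm with ⟨h, _⟩ | ⟨p, hp, hpw, hpS, hadj⟩
      · exact absurd rfl h
      · have hpz : p ≠ z := fun e => hxz (e ▸ hp)
        exact Relation.ReflTransGen.tail (hsub p hp)
          ⟨hadj, Finset.mem_erase.2 ⟨hpz, hpS⟩, Finset.mem_erase.2 ⟨hzw.symm, hwS⟩⟩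
    have hlt : (C w).card < (C z).card := by
      apply Finset.card_lt_card
      rw [Finset.ssubset_iff_of_subset]
      · refine ⟨w, Finset.mem_filter.2 ⟨hwS, hw⟩, ?_⟩
        intro h
        have := (Finset.mem_filter.1 h).2.mem (Finset.mem_erase.2 ⟨hwx.symm, hx⟩)
        simp at this
      · intro v hv
        obtain ⟨a, b⟩ := Finset.mem_filter.1 hv
        exact Finset.mem_filter.2 ⟨a, hsub v b⟩
    exact absurd (hmax z hzK) (by omega)
  intro y hy z hz
  rw [Finset.mem_erase] at hy hz
  exact (key y hy.2 hy.1).symm.trans (key z hz.2 hz.1)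

theorem OneSide.step {V : Type*} [DecidableEq V] {G : SimpleGraph V} {S T : Finset V}
    {Y : V → V → Prop} (h1 : OneSide G S T Y) {u w d b : V} (hb : b ∈ T) (hbw : b ≠ w)
    (hub : Y u b) (hd : d ∈ T) (hwd : G.Adj w d) :
    OneSide G (S.erase u) (T.erase w)
      (fun p q => Y p q ∨ (G.Adj p u ∧ Y u q) ∨ (Y p w ∧ G.Adj w q)) := by
  intro x hx y hy hyx
  rw [Finset.mem_erase] at hx hy
  obtain ⟨z, hz, hzx, hyz, a, ha, hza⟩ := h1 x hx.2 y hy.2 hyx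
  revert hyx hy
  unfold RS at hyz
  induction hyz using Relation.ReflTransGen.head_induction_on with
  | refl =>
    intro hy _
    refine ⟨z, Finset.mem_erase.2 hy, hzx, .refl, ?_⟩
    by_cases haw : a = w
    · subst haw
      exact ⟨d, Finset.mem_erase.2 ⟨hwd.ne', hd⟩, Or.inr (Or.inr ⟨hza, hwd⟩)⟩
    · exact ⟨a, Finset.mem_erase.2 ⟨haw, ha⟩, Or.inl hza⟩
  | @head y y1 h _ ih =>
    intro hy hyx
    by_cases hu : y1 = u
    · subst hu
      exact ⟨y, Finset.mem_erase.2 hy, hyx, .refl, b, Finset.mem_erase.2 ⟨hbw, hb⟩,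
        Or.inr (Or.inl ⟨h.1, hub⟩)⟩
    · have hy1 := Finset.mem_erase.1 h.2.2
      obtain ⟨z', hz', hz'x, hr, hh⟩ := ih ⟨hu, hy1.2⟩ hy1.1
      refine ⟨z', hz', hz'x, Relation.ReflTransGen.head ⟨h.1, ?_, ?_⟩ hr, hh⟩
      · simp only [Finset.mem_erase]; exact ⟨hyx, hy⟩
      · simp only [Finset.mem_erase]; exact ⟨hy1.1, hu, hy1.2⟩

/-- A good connection between `u ∈ L` and `w ∈ U`. -/
def GoodConn {V : Type*} (G : SimpleGraph V) (L U : Finset V) (X : V → V → Prop) (c : V → ℕ)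
    (u w : V) : Prop :=
  ∃ A B : Finset V, A ⊆ L ∧ B ⊆ U ∧ ∃ a ∈ A, ∃ b ∈ B, u ∈ A ∧ w ∈ B ∧ RS G A u a ∧
    RS G B b w ∧ X a b ∧ ∀ s ∈ A, ∀ t ∈ B, c s = c t → s = u ∧ t = w

theorem main_coloring {V : Type*} [DecidableEq V] (G : SimpleGraph V) :
    ∀ (n : ℕ) (L U : Finset V) (X : V → V → Prop), U.card = n + 1 → U.card ≤ L.card →
      L.card ≤ U.card + 1 → Disjoint L U → CS G L → CS G U → (∃ a ∈ L, ∃ b ∈ U, X a b) →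
      OneSide G L U X → OneSide G U L (fun p q => X q p) →
      ∃ c : V → ℕ, Set.InjOn c L ∧ Set.InjOn c U ∧ (∀ v ∈ L, c v < L.card) ∧
        (∀ v ∈ U, c v < L.card) ∧ ∀ u ∈ L, ∀ w ∈ U, GoodConn G L U X c u w := by
  intro n
  induction n with
  | zero =>
    intro L U X hU hUL hLU hdis hL hU' hX h1 h2
    obtain ⟨b, rfl⟩ := Finset.card_eq_one.1 hU
    have hall : ∀ u ∈ L, X u b := by
      intro u hu
      obtain ⟨a, ha, b', hb', hab⟩ := hX
      rw [Finset.mem_singleton] at hb'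
      subst hb'
      by_cases hau : a = u
      · exact hau ▸ hab
      · obtain ⟨z, hz, hza, _, b2, hb2, hzb⟩ := h1 a ha u hu (Ne.symm hau)
        rw [Finset.mem_singleton] at hb2
        subst hb2
        have : z = u := by
          by_contra hzu
          have hsub : ({a, u, z} : Finset V) ⊆ L := by
            intro t; simp only [Finset.mem_insert, Finset.mem_singleton]
            rintro (rfl | rfl | rfl) <;> assumption
          have := Finset.card_le_card hsub
          rw [Finset.card_eq_three.2 ⟨a, u, z, hau, Ne.symm hza, Ne.symm hzu, rfl⟩] at this
          simp at hLU
          omega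
        exact this ▸ hzb
    have hbL : b ∉ L := fun h => Finset.disjoint_left.1 hdis h (Finset.mem_singleton_self b)
    let e := L.equivFin
    refine ⟨fun v => if h : v ∈ L then (e ⟨v, h⟩).val else 0, ?_, ?_, ?_, ?_, ?_⟩
    · intro x hx y hy hxy
      have hx' : x ∈ L := hx
      have hy' : y ∈ L := hy
      simp only [hx', hy', dif_pos] at hxy
      have := e.injective (Fin.ext hxy)
      exact congrArg Subtype.val this
    · intro x hx y hy _
      simp at hx hy
      rw [hx, hy]
    · intro v hv
      simp only [hv, dif_pos]
      exact (e ⟨v, hv⟩).isLt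
    · intro v hv
      rw [Finset.mem_singleton] at hv
      subst hv
      simp only [hbL, dif_neg, not_false_eq_true]
      omega
    · intro u hu w hw
      rw [Finset.mem_singleton] at hw
      subst hw
      refine ⟨{u}, {w}, by simpa using hu, by simp, u, by simp, w, by simp, by simp, by simp,
        .refl, .refl, hall u hu, ?_⟩
      intro s hs t ht _
      exact ⟨Finset.mem_singleton.1 hs, Finset.mem_singleton.1 ht⟩
  | succ n ih =>
    intro L U X hUc hUL hLU hdis hL hU hX h1 h2
    have hL2 : 2 ≤ L.card := by omega
    have hU2 : 2 ≤ U.card := by omega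
    -- choose the pair
    obtain ⟨u, hu, w, hw, hLu, hUw, ⟨b, hb, hbw, hub⟩, ⟨a, ha, hau, haw⟩⟩ :
        ∃ u ∈ L, ∃ w ∈ U, CS G (L.erase u) ∧ CS G (U.erase w) ∧
          (∃ b ∈ U, b ≠ w ∧ X u b) ∧ (∃ a ∈ L, a ≠ u ∧ X a w) := by
      obtain ⟨a0, ha0, b0, hb0, _⟩ := hX
      obtain ⟨u1, hu1, _, hcu1, b1, hb1, hub1⟩ := candidate hL h1 hL2 ha0
      obtain ⟨u2, hu2, hu21, hcu2, b2, hb2, hub2⟩ := candidate hL h1 hL2 hu1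
      obtain ⟨w1, hw1, _, hcw1, a1, ha1, haw1⟩ := candidate hU h2 hU2 hb0
      obtain ⟨w2, hw2, hw21, hcw2, a2, ha2, haw2⟩ := candidate hU h2 hU2 hw1
      by_contra hno
      push Not at hno
      have n11 := hno u1 hu1 w1 hw1 hcu1 hcw1
      have n12 := hno u1 hu1 w2 hw2 hcu1 hcw2
      have n21 := hno u2 hu2 w1 hw1 hcu2 hcw1
      have n22 := hno u2 hu2 w2 hw2 hcu2 hcw2
      by_cases q1 : ∃ b ∈ U, b ≠ w1 ∧ X u1 b
      · obtain ⟨b, hb, hbw, hub⟩ := q1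
        have r := n11 ⟨b, hb, hbw, hub⟩
        -- `w1` is only adjacent to `u1`
        have e1 : a1 = u1 := by
          by_contra h
          exact r a1 ha1 h haw1
        have hb2w : b2 ≠ w1 := by
          rintro rfl
          exact r u2 hu2 hu21 hub2
        exact n21 ⟨b2, hb2, hb2w, hub2⟩ a1 ha1 (by rw [e1]; exact hu21.symm) haw1
      · push Not at q1
        have e1 : b1 = w1 := by
          by_contra h
          exact q1 b1 hb1 h hub1
        have ha2u : a2 ≠ u1 := by
          rintro rfl
          exact q1 w2 hw2 hw21 haw2
        exact n12 ⟨b1, hb1, by rw [e1]; exact hw21.symm, hub1⟩ a2 ha2 ha2u haw2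
    obtain ⟨p, hp, hup⟩ := hL.exists_adj hL2 hu
    obtain ⟨q, hq, hwq⟩ := hU.exists_adj hU2 hw
    have hdisj := Finset.disjoint_left.1 hdis
    have huw : u ≠ w := fun e => hdisj hu (e ▸ hw)
    have cL := Finset.card_erase_of_mem hu
    have cU := Finset.card_erase_of_mem hw
    let X2 : V → V → Prop :=
      fun s t => X s t ∨ (G.Adj s u ∧ X u t) ∨ (X s w ∧ G.Adj w t)
    obtain ⟨c, cinjL, cinjU, cltL, cltU, cgood⟩ := ih (L.erase u) (U.erase w) X2 (by omega)
      (by omega) (by omega)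
      (Finset.disjoint_of_subset_left (Finset.erase_subset _ _)
        (Finset.disjoint_of_subset_right (Finset.erase_subset _ _) hdis)) hLu hUw
      ⟨p, Finset.mem_erase.2 ⟨hup.ne', hp⟩, b, Finset.mem_erase.2 ⟨hbw, hb⟩,
        Or.inr (Or.inl ⟨hup.symm, hub⟩)⟩
      (h1.step hb hbw hub hq hwq)
      (by
        have := OneSide.step h2 (u := w) (w := u) ha hau haw hp hup
        intro x hx y hy hyx
        obtain ⟨z, hz, hzx, hr, a', ha', hh⟩ := this x hx y hy hyx
        refine ⟨z, hz, hzx, hr, a', ha', ?_⟩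
        rcases hh with h | ⟨h, h'⟩ | ⟨h, h'⟩
        · exact Or.inl h
        · exact Or.inr (Or.inr ⟨h', h.symm⟩)
        · exact Or.inr (Or.inl ⟨h'.symm, h⟩))
    let c' : V → ℕ := fun v => if v = u ∨ v = w then L.card - 1 else c v
    have c'u : c' u = L.card - 1 := by simp [c']
    have c'w : c' w = L.card - 1 := by simp [c']
    have c'o : ∀ v, v ≠ u → v ≠ w → c' v = c v := by
      intro v h h'; simp [c', h, h']
    have c'L : ∀ v ∈ L, v ≠ u → c' v = c v ∧ c v < L.card - 1 := by
      intro v hv h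
      refine ⟨c'o v h (fun e => hdisj hv (e ▸ hw)), ?_⟩
      have := cltL v (Finset.mem_erase.2 ⟨h, hv⟩)
      omega
    have c'U : ∀ v ∈ U, v ≠ w → c' v = c v ∧ c v < L.card - 1 := by
      intro v hv h
      refine ⟨c'o v (fun e => hdisj (e ▸ hu) hv) h, ?_⟩
      have := cltU v (Finset.mem_erase.2 ⟨h, hv⟩)
      omega
    refine ⟨c', ?_, ?_, ?_, ?_, ?_⟩
    · intro x hx y hy hxy
      have hx' : x ∈ L := hx
      have hy' : y ∈ L := hy
      by_cases e1 : x = u <;> by_cases e2 : y = u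
      · rw [e1, e2]
      · have := c'L y hy' e2
        rw [e1, c'u] at hxy; omega
      · have := c'L x hx' e1
        rw [e2, c'u] at hxy; omega
      · have r1 := c'L x hx' e1
        have r2 := c'L y hy' e2
        exact cinjL (Finset.mem_coe.2 (Finset.mem_erase.2 ⟨e1, hx'⟩))
          (Finset.mem_coe.2 (Finset.mem_erase.2 ⟨e2, hy'⟩)) (by omega)
    · intro x hx y hy hxy
      have hx' : x ∈ U := hx
      have hy' : y ∈ U := hy
      by_cases e1 : x = w <;> by_cases e2 : y = w
      · rw [e1, e2]
      · have := c'U y hy' e2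
        rw [e1, c'w] at hxy; omega
      · have := c'U x hx' e1
        rw [e2, c'w] at hxy; omega
      · have r1 := c'U x hx' e1
        have r2 := c'U y hy' e2
        exact cinjU (Finset.mem_coe.2 (Finset.mem_erase.2 ⟨e1, hx'⟩))
          (Finset.mem_coe.2 (Finset.mem_erase.2 ⟨e2, hy'⟩)) (by omega)
    · intro v hv
      by_cases e : v = u
      · rw [e, c'u]; omega
      · have := c'L v hv e; omega
    · intro v hv
      by_cases e : v = w
      · rw [e, c'w]; omega
      · have := c'U v hv e; omega
    · intro x hx y hy
      by_cases e1 : x = u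
      · subst e1
        by_cases e2 : y = w
        · subst e2
          -- from `x` to its twin
          refine ⟨{x}, U, by simpa using hu, le_rfl, x, by simp, b, hb, by simp, hw, .refl,
            hU b hb y hw, hub, ?_⟩
          intro s hs t ht hst
          rw [Finset.mem_singleton] at hs
          subst hs
          refine ⟨rfl, ?_⟩
          by_contra h
          have := c'U t ht h
          rw [c'u] at hst; omega
        · refine ⟨{x}, U.erase w, by simpa using hu, Finset.erase_subset _ _, x, by simp, b,
            Finset.mem_erase.2 ⟨hbw, hb⟩, by simp, Finset.mem_erase.2 ⟨e2, hy⟩, .refl,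
            hUw b (Finset.mem_erase.2 ⟨hbw, hb⟩) y (Finset.mem_erase.2 ⟨e2, hy⟩), hub, ?_⟩
          intro s hs t ht hst
          rw [Finset.mem_singleton] at hs
          subst hs
          rw [Finset.mem_erase] at ht
          have := c'U t ht.2 ht.1
          rw [c'u] at hst; omega
      · by_cases e2 : y = w
        · subst e2
          refine ⟨L.erase u, {y}, Finset.erase_subset _ _, by simpa using hw, a,
            Finset.mem_erase.2 ⟨hau, ha⟩, y, by simp, Finset.mem_erase.2 ⟨e1, hx⟩, by simp,
            hLu x (Finset.mem_erase.2 ⟨e1, hx⟩) a (Finset.mem_erase.2 ⟨hau, ha⟩), .refl,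
            haw, ?_⟩
          intro s hs t ht hst
          rw [Finset.mem_singleton] at ht
          subst ht
          rw [Finset.mem_erase] at hs
          have := c'L s hs.2 hs.1
          rw [c'w] at hst; omega
        · obtain ⟨A, B, hA, hB, s0, hs0, t0, ht0, hxA, hyB, hrA, hrB, hX2, hcol⟩ :=
            cgood x (Finset.mem_erase.2 ⟨e1, hx⟩) y (Finset.mem_erase.2 ⟨e2, hy⟩)
          have hA' : ∀ s ∈ A, s ≠ u ∧ s ∈ L := fun s hs => Finset.mem_erase.1 (hA hs)
          have hB' : ∀ s ∈ B, s ≠ w ∧ s ∈ U := fun s hs => Finset.mem_erase.1 (hB hs)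
          have hcol' : ∀ s ∈ A, ∀ t ∈ B, c' s = c' t → s = x ∧ t = y := by
            intro s hs t ht hst
            have r1 := c'L s (hA' s hs).2 (hA' s hs).1
            have r2 := c'U t (hB' t ht).2 (hB' t ht).1
            exact hcol s hs t ht (by omega)
          have hAL : A ⊆ L := fun s hs => (hA' s hs).2
          have hBU : B ⊆ U := fun s hs => (hB' s hs).2
          rcases hX2 with h | ⟨h, h'⟩ | ⟨h, h'⟩
          · exact ⟨A, B, hAL, hBU, s0, hs0, t0, ht0, hxA, hyB, hrA, hrB, h, hcol'⟩
          · refine ⟨insert u A, B, Finset.insert_subset hu hAL, hBU, u, by simp, t0, ht0,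
              by simp [hxA], hyB, Relation.ReflTransGen.tail (hrA.mono (Finset.subset_insert _ _))
              ⟨h, by simp [hs0], by simp⟩, hrB, h', ?_⟩
            intro s hs t ht hst
            rcases Finset.mem_insert.1 hs with rfl | hs
            · have := c'U t (hB' t ht).2 (hB' t ht).1
              rw [c'u] at hst; omega
            · exact hcol' s hs t ht hst
          · refine ⟨A, insert w B, hAL, Finset.insert_subset hw hBU, s0, hs0, w, by simp,
              hxA, by simp [hyB], hrA, Relation.ReflTransGen.head ⟨h', by simp, by simp [ht0]⟩
              (hrB.mono (Finset.subset_insert _ _)), h, ?_⟩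
            intro s hs t ht hst
            rcases Finset.mem_insert.1 ht with rfl | ht
            · have := c'L s (hA' s hs).2 (hA' s hs).1
              rw [c'w] at hst; omega
            · exact hcol' s hs t ht hst

theorem RS.toWalk {V : Type*} {G : SimpleGraph V} {S : Finset V} {x y : V}
    (hr : RS G S x y) (hx : x ∈ S) : ∃ p : G.Walk x y, p.IsPath ∧ ∀ z ∈ p.support, z ∈ S := by
  classical
  have : ∃ p : G.Walk x y, ∀ z ∈ p.support, z ∈ S := by
    unfold RS at hr
    induction hr using Relation.ReflTransGen.head_induction_on with
    | refl => exact ⟨.nil, by simpa using hx⟩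
    | @head a b h _ ih =>
      obtain ⟨p, hp⟩ := ih h.2.2
      refine ⟨.cons h.1 p, ?_⟩
      intro z hz
      rw [SimpleGraph.Walk.support_cons, List.mem_cons] at hz
      rcases hz with rfl | hz
      · exact h.2.1
      · exact hp z hz
  obtain ⟨p, hp⟩ := this
  exact ⟨p.bypass, p.bypass_isPath, fun z hz => hp z (p.support_bypass_subset_support hz)⟩

theorem oneSide_of_del {V : Type*} [DecidableEq V] {G : SimpleGraph V} {S T : Finset V}
    (hcov : ∀ v, v ∈ S ∨ v ∈ T) (hdis : Disjoint S T) (hT : T.Nonempty)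
    (h : ∀ v, (G.induce {u | u ≠ v}).Connected) : OneSide G S T G.Adj := by
  intro x hx y hy hyx
  obtain ⟨t, ht⟩ := hT
  have hd := Finset.disjoint_left.1 hdis
  have htx : t ≠ x := fun e => hd hx (e ▸ ht)
  obtain ⟨p⟩ := (h x).preconnected ⟨y, hyx⟩ ⟨t, htx⟩
  have gen : ∀ (a b : {u | u ≠ x}) (_ : (G.induce {u | u ≠ x}).Walk a b), a.1 ∈ S → b.1 ∈ T →
      ∃ z ∈ S, z ≠ x ∧ RS G (S.erase x) a.1 z ∧ ∃ a ∈ T, G.Adj z a := by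
    intro a b p
    induction p with
    | nil => intro h1 h2; exact absurd h2 (hd h1)
    | @cons a b c hab p ih =>
      intro h1 h2
      have hab' : G.Adj a.1 b.1 := hab
      rcases hcov b.1 with hb | hb
      · obtain ⟨z, hz, hzx, hr, hh⟩ := ih hb h2
        exact ⟨z, hz, hzx, Relation.ReflTransGen.head
          ⟨hab', Finset.mem_erase.2 ⟨a.2, h1⟩, Finset.mem_erase.2 ⟨b.2, hb⟩⟩ hr, hh⟩
      · exact ⟨a.1, h1, a.2, .refl, b.1, hb, hab'⟩
  exact gen _ _ p hy ht

theorem exists_partition {V : Type*} [Fintype V] [DecidableEq V] {G : SimpleGraph V}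
    (h : ∀ v, (G.induce {u | u ≠ v}).Connected) (v0 : V) :
    ∀ k, k + 2 ≤ Fintype.card V → ∃ U : Finset V, U.card = k + 1 ∧ CS G U ∧ CS G Uᶜ := by
  intro k
  induction k with
  | zero =>
    intro _
    refine ⟨{v0}, by simp, ?_, ?_⟩
    · intro x hx y hy
      rw [Finset.mem_singleton] at hx hy
      subst hx; subst hy
      exact .refl
    · intro x hx y hy
      have hx' : x ≠ v0 := by simpa using hx
      have hy' : y ≠ v0 := by simpa using hy
      obtain ⟨p⟩ := (h v0).preconnected ⟨x, hx'⟩ ⟨y, hy'⟩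
      have gen : ∀ (a b : {u | u ≠ v0}) (_ : (G.induce {u | u ≠ v0}).Walk a b),
          RS G ({v0}ᶜ : Finset V) a.1 b.1 := by
        intro a b p
        induction p with
        | nil => exact .refl
        | @cons a b c hab p ih =>
          have hab' : G.Adj a.1 b.1 := hab
          exact Relation.ReflTransGen.head
            ⟨hab', Finset.mem_compl.2 (fun e => a.2 (Finset.mem_singleton.1 e)),
              Finset.mem_compl.2 (fun e => b.2 (Finset.mem_singleton.1 e))⟩ ih
      exact gen _ _ p
  | succ k ih =>
    intro hk
    obtain ⟨U, hUc, hU, hL⟩ := ih (by omega)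
    have hLc : Uᶜ.card = Fintype.card V - U.card := Finset.card_compl U
    obtain ⟨x, hx⟩ : (Uᶜ : Finset V).Nonempty := Finset.card_pos.1 (by omega)
    have hne : U.Nonempty := Finset.card_pos.1 (by omega)
    obtain ⟨w, hw, _, hc, a, ha, hwa⟩ := candidate hL (T := U)
      (oneSide_of_del (by intro v; rw [Finset.mem_compl]; tauto)
        disjoint_compl_left hne h) (by omega) hx
    refine ⟨insert w U, ?_, ?_, ?_⟩
    · rw [Finset.card_insert_of_notMem (by simpa using hw), hUc]
    · have key : ∀ y ∈ insert w U, RS G (insert w U) w y := by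
        intro y hy
        rcases Finset.mem_insert.1 hy with rfl | hy
        · exact .refl
        · exact Relation.ReflTransGen.head ⟨hwa, by simp, by simp [ha]⟩
            ((hU a ha y hy).mono (Finset.subset_insert _ _))
      intro y hy z hz
      exact (key y hy).symm.trans (key z hz)
    · rw [Finset.compl_insert]
      exact hc

theorem rainbow_of_path {V : Type*} {G : SimpleGraph V} {u v : V} (c : V → ℕ) (p : G.Walk u v)
    (hp : p.IsPath) (huv : u ≠ v)
    (h : ∀ s ∈ p.support, ∀ t ∈ p.support, s ≠ u → s ≠ v → t ≠ u → t ≠ v → c s = c t → s = t) :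
    p.IsRainbowPath c := by
  refine ⟨hp, ?_⟩
  cases p with
  | nil => exact absurd rfl huv
  | @cons _ x _ hadj q =>
    have hq := hp.support_nodup
    rw [SimpleGraph.Walk.support_cons, List.nodup_cons] at hq
    have hint : (SimpleGraph.Walk.cons hadj q).internalVertices = q.support.dropLast := by
      simp [SimpleGraph.Walk.internalVertices]
    rw [hint]
    have hdl : q.support.dropLast ++ [v] = q.support := by
      have := List.dropLast_append_getLast q.support_ne_nil
      rwa [SimpleGraph.Walk.getLast_support] at this
    have hnd : (q.support.dropLast ++ [v]).Nodup := by rw [hdl]; exact hq.2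
    have hprop : ∀ s ∈ q.support.dropLast, s ∈ q.support ∧ s ≠ u ∧ s ≠ v := by
      intro s hs
      have h1 : s ∈ q.support := List.mem_of_mem_dropLast hs
      refine ⟨h1, fun e => hq.1 (e ▸ h1), ?_⟩
      rintro rfl
      rw [List.nodup_append] at hnd
      exact hnd.2.2 s hs s (by simp) rfl
    apply List.Nodup.map_on
    · intro s hs t ht hst
      obtain ⟨a1, a2, a3⟩ := hprop s hs
      obtain ⟨b1, b2, b3⟩ := hprop t ht
      exact h s (by simp [a1]) t (by simp [b1]) a2 a3 b2 b3 hst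
    · exact (List.nodup_append.1 hnd).1

/-- every 2-connected graph of order `n ≥ 3` satisfies
`rvc G ≤ ⌈n/2⌉`.  (Here `⌈n/2⌉ = (n + 1) / 2` with natural division.) -/
theorem rvc_le_ceil_half_of_twoConnected {V : Type*} [Fintype V] (G : SimpleGraph V)
    (hn : 3 ≤ Fintype.card V) (hconn : G.Connected)
    (hdel : ∀ v : V, (G.induce {u | u ≠ v}).Connected) :
    G.rvc ≤ (Fintype.card V + 1) / 2 := by
  classical
  obtain ⟨v0⟩ := hconn.nonempty
  obtain ⟨U, hUc, hU, hL⟩ := exists_partition hdel v0 (Fintype.card V / 2 - 1) (by omega)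
  have hLc : Uᶜ.card = Fintype.card V - U.card := Finset.card_compl U
  generalize hLdef : Uᶜ = L at hL hLc
  have hmem : ∀ v, v ∈ L ↔ v ∉ U := by intro v; rw [← hLdef, Finset.mem_compl]
  have hdis : Disjoint L U := by rw [← hLdef]; exact disjoint_compl_left
  have hLne : L.Nonempty := Finset.card_pos.1 (by omega)
  have hUne : U.Nonempty := Finset.card_pos.1 (by omega)
  have o1 : OneSide G L U G.Adj :=
    oneSide_of_del (by intro v; rw [hmem]; tauto) hdis hUne hdel
  have o2 : OneSide G U L G.Adj :=
    oneSide_of_del (by intro v; rw [hmem]; tauto) hdis.symm hLne hdel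
  have hcross : ∃ a ∈ L, ∃ b ∈ U, G.Adj a b := by
    obtain ⟨x, hx⟩ := hLne
    obtain ⟨w, hw, _, _, h⟩ := candidate hL o1 (by omega) hx
    exact ⟨w, hw, h⟩
  obtain ⟨c, iL, iU, lL, lU, good⟩ := main_coloring G (Fintype.card V / 2 - 1) L U G.Adj hUc
    (by omega) (by omega) hdis hL hU hcross o1
    (by
      intro x hx y hy hyx
      obtain ⟨z, hz, hzx, hr, a, ha, h⟩ := o2 x hx y hy hyx
      exact ⟨z, hz, hzx, hr, a, ha, h.symm⟩)
  have hk : L.card = (Fintype.card V + 1) / 2 := by omega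
  have hlt : ∀ v, c v < (Fintype.card V + 1) / 2 := by
    intro v
    rw [← hk]
    by_cases h : v ∈ U
    · exact lU v h
    · exact lL v ((hmem v).2 h)
  have cross : ∀ u ∈ L, ∀ v ∈ U, ∃ p : G.Walk u v, p.IsPath ∧
      ∀ s ∈ p.support, ∀ t ∈ p.support, s ≠ u → s ≠ v → t ≠ u → t ≠ v → c s = c t → s = t := by
    intro u hu v hv
    obtain ⟨A, B, hA, hB, a, ha, b, hb, huA, hvB, hrA, hrB, hab, hcol⟩ := good u hu v hv
    obtain ⟨p, hp, hpA⟩ := hrA.toWalk huA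
    obtain ⟨q, hq, hqB⟩ := hrB.toWalk hb
    have hsup : ∀ s ∈ (p.append (.cons hab q)).support, s ∈ A ∨ s ∈ B := by
      intro s hs
      rw [SimpleGraph.Walk.mem_support_append_iff, SimpleGraph.Walk.support_cons,
        List.mem_cons] at hs
      rcases hs with hs | rfl | hs
      · exact Or.inl (hpA s hs)
      · exact Or.inl ha
      · exact Or.inr (hqB s hs)
    refine ⟨p.append (.cons hab q), ?_, ?_⟩
    · rw [SimpleGraph.Walk.isPath_def, SimpleGraph.Walk.support_append,
        SimpleGraph.Walk.support_cons, List.tail_cons, List.nodup_append]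
      refine ⟨hp.support_nodup, hq.support_nodup, ?_⟩
      rintro s hs t ht rfl
      exact Finset.disjoint_left.1 hdis (hA (hpA s hs)) (hB (hqB s ht))
    · intro s hs t ht su sv tu tv hst
      rcases hsup s hs with h1 | h1 <;> rcases hsup t ht with h2 | h2
      · exact iL (hA h1) (hA h2) hst
      · exact absurd (hcol s h1 t h2 hst).1 su
      · exact absurd (hcol t h2 s h1 hst.symm).1 tu
      · exact iU (hB h1) (hB h2) hst
  apply Nat.sInf_le
  refine ⟨c, ?_⟩
  intro u v huv
  suffices h : ∃ p : G.Walk u v, p.IsPath ∧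
      ∀ s ∈ p.support, ∀ t ∈ p.support, s ≠ u → s ≠ v → t ≠ u → t ≠ v → c s = c t → s = t by
    obtain ⟨p, hp, h⟩ := h
    exact ⟨p, rainbow_of_path c p hp huv h, fun w _ => hlt w⟩
  by_cases hu : u ∈ U <;> by_cases hv : v ∈ U
  · obtain ⟨p, hp, h⟩ := (hU u hu v hv).toWalk hu
    exact ⟨p, hp, fun s hs t ht _ _ _ _ e => iU (h s hs) (h t ht) e⟩
  · obtain ⟨p, hp, h⟩ := cross v ((hmem v).2 hv) u hu
    refine ⟨p.reverse, hp.reverse, ?_⟩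
    intro s hs t ht a1 a2 a3 a4 e
    exact h s (by simpa using hs) t (by simpa using ht) a2 a1 a4 a3 e
  · exact cross u ((hmem u).2 hu) v hv
  · obtain ⟨p, hp, h⟩ := (hL u ((hmem u).2 hu) v ((hmem v).2 hv)).toWalk ((hmem u).2 hu)
    exact ⟨p, hp, fun s hs t ht _ _ _ _ e => iL (h s hs) (h t ht) e⟩
end

section
/- Let G be a connected graph whose block decomposition consists of the blocks B_1, B_2, …, B_k, and suppose G has exactly t cut vertices. Then rvc(G) ≤ rvc(B_1) + rvc(B_2) + ⋯ + rvc(B_k) + t. -/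
namespace RvcAux

open SimpleGraph

variable {V : Type*} {G : SimpleGraph V}

/-- `x` and `y` are joined by a walk of `G` inside `A`. -/
def R (G : SimpleGraph V) (A : Set V) (x y : V) : Prop :=
  ∃ p : G.Walk x y, ∀ z ∈ p.support, z ∈ A

lemma R.symm {A : Set V} {x y : V} (h : R G A x y) : R G A y x := by
  obtain ⟨p, hp⟩ := h
  exact ⟨p.reverse, by simpa using hp⟩

lemma R.trans {A : Set V} {x y z : V} (h : R G A x y) (h' : R G A y z) : R G A x z := by
  obtain ⟨p, hp⟩ := h
  obtain ⟨q, hq⟩ := h'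
  refine ⟨p.append q, fun w hw => ?_⟩
  rcases (Walk.mem_support_append_iff p q).1 hw with h | h
  · exact hp _ h
  · exact hq _ h

lemma R.mono {A A' : Set V} {x y : V} (h : R G A x y) (hA : A ⊆ A') : R G A' x y := by
  obtain ⟨p, hp⟩ := h
  exact ⟨p, fun z hz => hA (hp z hz)⟩

lemma R.refl {A : Set V} {x : V} (h : x ∈ A) : R G A x x :=
  ⟨Walk.nil, by simpa using h⟩

/-- Set-level connectivity. -/
def Cn (G : SimpleGraph V) (A : Set V) : Prop := ∀ x ∈ A, ∀ y ∈ A, R G A x y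

lemma preconn_iff (A : Set V) : (G.induce A).Preconnected ↔ Cn G A := by
  constructor
  · intro h x hx y hy
    obtain ⟨p⟩ := h ⟨x, hx⟩ ⟨y, hy⟩
    refine ⟨p.map (Embedding.induce A).toHom, fun z hz => ?_⟩
    replace hz := (Walk.support_map (Embedding.induce A).toHom p) ▸ hz
    rw [List.mem_map] at hz
    obtain ⟨a, -, rfl⟩ := hz
    exact a.2
  · rintro h ⟨x, hx⟩ ⟨y, hy⟩
    obtain ⟨p, hp⟩ := h x hx y hy
    exact ⟨p.induce A hp⟩

lemma cn_hub {A : Set V} (h : V) (hh : ∀ x ∈ A, R G A x h) : Cn G A :=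
  fun x hx y hy => (hh x hx).trans (hh y hy).symm

lemma cut_iff (A : Set V) (w : V) (hw : w ∈ A) :
    ¬ (G.induce A).IsCutVertex ⟨w, hw⟩ ↔ Cn G (A \ {w}) := by
  unfold SimpleGraph.IsCutVertex
  rw [not_not, preconn_iff]
  constructor
  · intro h x hx y hy
    obtain ⟨p, hp⟩ := h ⟨x, hx.1⟩ (fun e => hx.2 (congrArg Subtype.val e)) ⟨y, hy.1⟩
      (fun e => hy.2 (congrArg Subtype.val e))
    refine ⟨p.map (Embedding.induce A).toHom, fun z hz => ?_⟩
    replace hz := (Walk.support_map (Embedding.induce A).toHom p) ▸ hz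
    rw [List.mem_map] at hz
    obtain ⟨a, ha, rfl⟩ := hz
    exact ⟨a.2, fun e => hp a ha (Subtype.ext e)⟩
  · rintro h ⟨x, hxA⟩ hx ⟨y, hyA⟩ hy
    obtain ⟨p, hp⟩ := h x ⟨hxA, fun e => hx (Subtype.ext e)⟩ y
      ⟨hyA, fun e => hy (Subtype.ext e)⟩
    refine ⟨p.induce A (fun z hz => (hp z hz).1), fun z hz => ?_⟩
    have hz' : z.1 ∈ p.support := by simpa using hz
    intro e
    exact (hp _ hz').2 (congrArg Subtype.val e)

/-- Nonempty, connected, no cut vertex. -/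
def Good (G : SimpleGraph V) (A : Set V) : Prop :=
  A.Nonempty ∧ Cn G A ∧ ∀ w, Cn G (A \ {w})

lemma good_iff (A : Set V) :
    Good G A ↔ (G.induce A).Connected ∧ ∀ v, ¬ (G.induce A).IsCutVertex v := by
  constructor
  · rintro ⟨h1, h2, h3⟩
    refine ⟨?_, fun v => (cut_iff A v.1 v.2).2 (h3 v.1)⟩
    have : Nonempty A := h1.to_subtype
    exact ⟨(preconn_iff A).2 h2⟩
  · rintro ⟨h1, h2⟩
    have hc := (preconn_iff A).1 h1.preconnected
    refine ⟨Set.nonempty_coe_sort.1 h1.nonempty, hc, fun w => ?_⟩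
    by_cases hw : w ∈ A
    · exact (cut_iff A w hw).1 (h2 ⟨w, hw⟩)
    · rwa [Set.sdiff_singleton_eq_self hw]

lemma block_iff (A : Set V) :
    G.IsBlock A ↔ Good G A ∧ ∀ C, A ⊆ C → Good G C → C = A := by
  unfold SimpleGraph.IsBlock
  rw [good_iff, and_assoc]
  simp only [good_iff, and_imp]

lemma exists_block [Finite V] {A : Set V} (h : Good G A) : ∃ C, A ⊆ C ∧ G.IsBlock C := by
  obtain ⟨C, hC, hm⟩ := Finite.exists_le_maximal h
  refine ⟨C, hC, (block_iff C).2 ⟨hm.prop, fun D hD hg => ?_⟩⟩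
  exact (hm.eq_of_le hg hD).symm

lemma good_edge {u v : V} (h : G.Adj u v) : Good G {u, v} := by
  refine ⟨⟨u, by simp⟩, cn_hub u ?_, fun w => ?_⟩
  · rintro x (rfl | rfl)
    · exact R.refl (by simp)
    · exact ⟨Walk.cons h.symm Walk.nil, by simp⟩
  · by_cases hw : w = u ∨ w = v
    · rintro x ⟨hx, hxw⟩ y ⟨hy, hyw⟩
      have : x = y := by
        simp only [Set.mem_insert_iff, Set.mem_singleton_iff] at *
        grind
      subst this
      exact R.refl ⟨hx, hxw⟩
    · rw [Set.sdiff_singleton_eq_self (by simpa using hw)]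
      refine cn_hub u ?_
      rintro x (rfl | rfl)
      · exact R.refl (by simp)
      · exact ⟨Walk.cons h.symm Walk.nil, by simp⟩

/-- A vertex in two distinct blocks is a cut vertex. -/
lemma cut_of_two {B C : Set V} (hB : G.IsBlock B) (hC : G.IsBlock C) (hne : B ≠ C) {v : V}
    (hvB : v ∈ B) (hvC : v ∈ C) : G.IsCutVertex v := by
  classical
  intro hpre
  rw [block_iff] at hB hC
  obtain ⟨⟨-, hB1, hB2⟩, hBm⟩ := hB
  obtain ⟨⟨hC0, hC1, hC2⟩, hCm⟩ := hC
  have hb : ∃ b ∈ B, b ∉ C := by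
    by_contra! hcon
    exact hne (hBm C hcon ⟨hC0, hC1, hC2⟩).symm
  have hc : ∃ c ∈ C, c ∉ B := by
    by_contra! hcon
    exact hne (hCm B hcon ⟨⟨v, hvB⟩, hB1, hB2⟩)
  obtain ⟨b, hbB, hbC⟩ := hb
  obtain ⟨c, hcC, hcB⟩ := hc
  have hbv : b ≠ v := by rintro rfl; exact hbC hvC
  have hcv : c ≠ v := by rintro rfl; exact hcB hvB
  obtain ⟨p0, hp0⟩ := (preconn_iff _).1 hpre b hbv c hcv
  obtain ⟨p, hpath, hp⟩ : ∃ p : G.Walk b c, p.IsPath ∧ ∀ z ∈ p.support, z ≠ v :=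
    ⟨p0.bypass, p0.bypass_isPath, fun z hz => hp0 z (p0.support_bypass_subset_support hz)⟩
  have htd : ∀ (D : Set V) (z : V) (hz : z ∈ p.support) (w : V), w ≠ z →
      {x | x ∈ p.support} ⊆ D → R G (D \ {w}) z b ∨ R G (D \ {w}) z c := by
    intro D z hz w hwz hD
    by_cases hw : w ∈ (p.takeUntil z hz).support
    · right
      refine ⟨p.dropUntil z hz, fun x hx => ⟨hD (p.support_dropUntil_subset_support hz hx), ?_⟩⟩
      rintro rfl
      have h1 := hpath.support_nodup
      rw [← p.take_spec hz, Walk.support_append, List.nodup_append'] at h1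
      rw [Walk.support_eq_cons, List.mem_cons] at hx
      rcases hx with hx | hx
      · exact hwz hx
      · exact h1.2.2 hw hx
    · left
      refine R.symm ⟨p.takeUntil z hz, fun x hx =>
        ⟨hD (p.support_takeUntil_subset_support hz hx), ?_⟩⟩
      rintro rfl
      exact hw hx
  set D : Set V := B ∪ C ∪ {x | x ∈ p.support} with hDdef
  have hBD : B ⊆ D := fun x hx => Or.inl (Or.inl hx)
  have hCD : C ⊆ D := fun x hx => Or.inl (Or.inr hx)
  have hPD : {x | x ∈ p.support} ⊆ D := fun x hx => Or.inr hx
  have hgood : Good G D := by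
    refine ⟨⟨v, hBD hvB⟩, cn_hub v ?_, fun w => ?_⟩
    · rintro x ((hx | hx) | hx)
      · exact (hB1 x hx v hvB).mono hBD
      · exact (hC1 x hx v hvC).mono hCD
      · have h1 : R G D b x := ⟨p.takeUntil x hx, fun y hy =>
          hPD (p.support_takeUntil_subset_support hx hy)⟩
        exact h1.symm.trans ((hB1 b hbB v hvB).mono hBD)
    · have hBw : B \ {w} ⊆ D \ {w} := Set.diff_subset_diff_left hBD
      have hCw : C \ {w} ⊆ D \ {w} := Set.diff_subset_diff_left hCD
      by_cases hwv : w = v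
      · subst hwv
        have key : ∀ x (hx : x ∈ p.support), R G (D \ {w}) x b := fun x hx =>
          R.symm ⟨p.takeUntil x hx, fun y hy =>
            ⟨hPD (p.support_takeUntil_subset_support hx hy),
              hp y (p.support_takeUntil_subset_support hx hy)⟩⟩
        refine cn_hub b ?_
        rintro x ⟨(hx | hx) | hx, hxw⟩
        · exact (hB2 w x ⟨hx, hxw⟩ b ⟨hbB, hbv⟩).mono hBw
        · exact ((hC2 w x ⟨hx, hxw⟩ c ⟨hcC, hcv⟩).mono hCw).trans (key c p.end_mem_support)
        · exact key x hx
      · have hvw : v ∉ ({w} : Set V) := fun h => hwv h.symm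
        have kB : ∀ x ∈ B \ {w}, R G (D \ {w}) x v := fun x hx =>
          (hB2 w x hx v ⟨hvB, hvw⟩).mono hBw
        have kC : ∀ x ∈ C \ {w}, R G (D \ {w}) x v := fun x hx =>
          (hC2 w x hx v ⟨hvC, hvw⟩).mono hCw
        refine cn_hub v ?_
        rintro x ⟨(hx | hx) | hx, hxw⟩
        · exact kB x ⟨hx, hxw⟩
        · exact kC x ⟨hx, hxw⟩
        · rcases htd D x hx w (fun e => hxw e.symm) hPD with h | h
          · refine h.trans (kB b ⟨hbB, ?_⟩)
            obtain ⟨q, hq⟩ := h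
            exact (hq b q.end_mem_support).2
          · refine h.trans (kC c ⟨hcC, ?_⟩)
            obtain ⟨q, hq⟩ := h
            exact (hq c q.end_mem_support).2
  have : c ∈ B := by
    have := hBm D hBD hgood
    rw [← this]
    exact hCD hcC
  exact hcB this

/-- A chain of distinct blocks. -/
inductive Ch {ι : Type*} (B : ι → Set V) : Set ι → V → V → Prop
  | nil (u : V) : Ch B ∅ u u
  | cons (i : ι) (x y v : V) (I : Set ι) : i ∉ I → x ∈ B i → y ∈ B i → Ch B I y v →
      Ch B (insert i I) x v

lemma Ch.cutoff {ι : Type*} {B : ι → Set V} {I : Set ι} {x v : V} (h : Ch B I x v) (i : ι)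
    (hi : i ∈ I) : ∃ J y, i ∉ J ∧ y ∈ B i ∧ Ch B J y v := by
  induction h with
  | nil u => exact absurd hi (Set.notMem_empty _)
  | cons j x y v I hj hx hy hc ih =>
    rcases hi with rfl | hi
    · exact ⟨I, y, hj, hy, hc⟩
    · exact ih hi

lemma Ch.exists_of_walk {ι : Type*} {B : ι → Set V}
    (hE : ∀ u v, G.Adj u v → ∃ i, u ∈ B i ∧ v ∈ B i) {u v : V} (p : G.Walk u v) :
    ∃ I, Ch B I u v := by
  induction p with
  | nil => exact ⟨∅, Ch.nil _⟩
  | cons h p ih =>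
    obtain ⟨I, hI⟩ := ih
    obtain ⟨i, hu, hw⟩ := hE _ _ h
    by_cases hi : i ∈ I
    · obtain ⟨J, y, hJ, hy, hc⟩ := hI.cutoff i hi
      exact ⟨_, Ch.cons i _ y _ J hJ hu hy hc⟩
    · exact ⟨_, Ch.cons i _ _ _ I hi hu hw hI⟩

lemma Ch.start_mem {ι : Type*} {B : ι → Set V} {I : Set ι} {x v : V} (h : Ch B I x v)
    (hne : x ≠ v) : ∃ i ∈ I, x ∈ B i := by
  cases h with
  | nil => exact absurd rfl hne
  | cons i _ y _ I hi hx hy hc => exact ⟨i, Set.mem_insert _ _, hx⟩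

lemma Ch.main {ι : Type*} {B : ι → Set V} {cut : V → Prop}
    (hcut : ∀ i j, i ≠ j → ∀ v, v ∈ B i → v ∈ B j → cut v)
    (c : ι → V → ℕ) (k : ι → ℕ)
    (hseg : ∀ i, ∀ x ∈ B i, ∀ y ∈ B i, x ≠ y → ∃ T ⊆ B i, (∀ w ∈ T, c i w < k i) ∧
      Set.InjOn (c i) T ∧ R G (T ∪ {x, y}) x y)
    {I : Set ι} {x v : V} (h : Ch B I x v) :
    ∃ S : Set V, R G (S ∪ {x, v}) x v ∧
      (∀ w ∈ S, cut w ∨ ∃ i ∈ I, w ∈ B i ∧ c i w < k i) ∧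
      (∀ i, ∀ w ∈ S, ∀ w' ∈ S, ¬ cut w → ¬ cut w' → w ∈ B i → w' ∈ B i →
        c i w = c i w' → w = w') := by
  induction h with
  | nil u => exact ⟨∅, R.refl (by simp), by simp, by simp⟩
  | cons i x y v I hi hx hy hc ih =>
    obtain ⟨S, hR, ha, hb⟩ := ih
    by_cases hxy : x = y
    · subst hxy
      refine ⟨S, hR, fun w hw => ?_, hb⟩
      rcases ha w hw with h | ⟨j, hj, h⟩
      · exact Or.inl h
      · exact Or.inr ⟨j, Set.mem_insert_of_mem _ hj, h⟩
    · obtain ⟨T, hTB, hTk, hTinj, hTR⟩ := hseg i x hx y hy hxy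
      have hycut : y ≠ v → cut y := by
        intro hne
        obtain ⟨j, hj, hyj⟩ := hc.start_mem hne
        exact hcut i j (by rintro rfl; exact hi hj) y hy hyj
      refine ⟨S ∪ T ∪ {z | z = y ∧ y ≠ v}, ?_, ?_, ?_⟩
      · refine (hTR.mono ?_).trans (hR.mono ?_)
        · intro z hz
          simp only [Set.mem_union, Set.mem_insert_iff, Set.mem_singleton_iff,
            Set.mem_ofPred_eq] at *
          grind
        · intro z hz
          simp only [Set.mem_union, Set.mem_insert_iff, Set.mem_singleton_iff,
            Set.mem_ofPred_eq] at *
          grind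
      · rintro w ((hw | hw) | ⟨rfl, hw⟩)
        · rcases ha w hw with h | ⟨j, hj, h⟩
          · exact Or.inl h
          · exact Or.inr ⟨j, Set.mem_insert_of_mem _ hj, h⟩
        · exact Or.inr ⟨i, Set.mem_insert _ _, hTB hw, hTk w hw⟩
        · exact Or.inl (hycut hw)
      · have key : ∀ w ∈ S ∪ T ∪ {z | z = y ∧ y ≠ v}, ¬ cut w → ∀ j, w ∈ B j →
            (j = i ∧ w ∈ T) ∨ (j ≠ i ∧ w ∈ S) := by
          rintro w ((hw | hw) | ⟨rfl, hw⟩) hnc j hwj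
          · right
            refine ⟨?_, hw⟩
            rintro rfl
            rcases ha w hw with h | ⟨l, hl, h, -⟩
            · exact hnc h
            · exact hnc (hcut j l (by rintro rfl; exact hi hl) w hwj h)
          · left
            refine ⟨?_, hw⟩
            by_contra hji
            exact hnc (hcut j i hji w hwj (hTB hw))
          · exact absurd (hycut hw) hnc
        intro j w hw w' hw' hn hn' hj hj' heq
        rcases key w hw hn j hj with ⟨h1, h2⟩ | ⟨h1, h2⟩ <;>
          rcases key w' hw' hn' j hj' with ⟨h1', h2'⟩ | ⟨h1', h2'⟩
        · subst h1
          exact hTinj h2 h2' heq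
        · exact absurd h1 h1'
        · exact absurd h1' h1
        · exact hb j w h2 w' h2' hn hn' hj hj' heq

lemma mem_internal {u v : V} (p : G.Walk u v) {w : V} (hw : w ∈ p.support) :
    w = u ∨ w = v ∨ w ∈ p.internalVertices := by
  unfold SimpleGraph.Walk.internalVertices
  cases p with
  | nil => left; simpa using hw
  | cons h q =>
    rw [Walk.support_cons, List.mem_cons] at hw
    rcases hw with hw | hw
    · exact Or.inl hw
    · right
      rw [Walk.support_cons, List.tail_cons]
      rw [← List.dropLast_append_getLast q.support_ne_nil, List.mem_append,
        Walk.getLast_support, List.mem_singleton] at hw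
      tauto

lemma internal_of_path {u v : V} (p : G.Walk u v) (hp : p.IsPath) :
    p.internalVertices.Nodup ∧ ∀ w ∈ p.internalVertices, w ∈ p.support ∧ w ≠ u ∧ w ≠ v := by
  have hn := hp.support_nodup
  unfold SimpleGraph.Walk.internalVertices
  refine ⟨hn.tail.sublist (List.dropLast_sublist _), fun w hw => ?_⟩
  have hw1 : w ∈ p.support.tail := List.mem_of_mem_dropLast hw
  refine ⟨List.mem_of_mem_tail hw1, ?_, ?_⟩
  · rintro rfl
    rw [Walk.support_eq_cons, List.nodup_cons] at hn
    exact hn.1 hw1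
  · rintro rfl
    cases p with
    | nil => simp at hw
    | cons h q =>
      rw [Walk.support_cons, List.tail_cons] at hw
      rw [Walk.support_cons, List.nodup_cons] at hn
      have h2 := hn.2
      rw [← List.dropLast_append_getLast q.support_ne_nil, List.nodup_append',
        Walk.getLast_support] at h2
      exact h2.2.2 hw (List.mem_singleton_self _)

lemma rainbow_of_R {c : V → ℕ} {K : ℕ} {S : Set V} (hinj : Set.InjOn c S)
    (hK : ∀ w ∈ S, c w < K) {u v : V} (h : R G (S ∪ {u, v}) u v) :
    ∃ p : G.Walk u v, p.IsRainbowPath c ∧ ∀ w ∈ p.internalVertices, c w < K := by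
  classical
  obtain ⟨p0, hp0⟩ := h
  have hpath := p0.bypass_isPath
  obtain ⟨hn, hm⟩ := internal_of_path p0.bypass hpath
  have hS : ∀ w ∈ p0.bypass.internalVertices, w ∈ S := by
    intro w hw
    obtain ⟨h1, h2, h3⟩ := hm w hw
    rcases hp0 w (p0.support_bypass_subset_support h1) with h | h | h
    · exact h
    · exact absurd h h2
    · exact absurd h h3
  exact ⟨p0.bypass, ⟨hpath, hn.map_on fun x hx y hy e => hinj (hS x hx) (hS y hy) e⟩,
    fun w hw => hK w (hS w hw)⟩

lemma rvcWith_rvc [Finite V] (hc : G.Preconnected) : G.RVCWith G.rvc := by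
  classical
  have : ({k | G.RVCWith k}).Nonempty := by
    obtain ⟨n, ⟨e⟩⟩ := Finite.exists_equiv_fin V
    refine ⟨n, fun v => (e v : ℕ), fun u v _ => ?_⟩
    obtain ⟨p⟩ := hc u v
    refine rainbow_of_R (S := Set.univ) ?_ (fun w _ => (e w).2) ⟨p, by simp⟩
    intro x _ y _ h
    exact e.injective (Fin.ext h)
  exact Nat.sInf_mem this

lemma seg_of_rvcWith {A : Set V} {k : ℕ} (h : (G.induce A).RVCWith k) :
    ∃ c : V → ℕ, ∀ x ∈ A, ∀ y ∈ A, x ≠ y → ∃ T ⊆ A, (∀ w ∈ T, c w < k) ∧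
      Set.InjOn c T ∧ R G (T ∪ {x, y}) x y := by
  classical
  obtain ⟨c, hc⟩ := h
  refine ⟨fun v => if h : v ∈ A then c ⟨v, h⟩ else 0, fun x hx y hy hxy => ?_⟩
  obtain ⟨p, ⟨hp, hnd⟩, hk⟩ := hc ⟨x, hx⟩ ⟨y, hy⟩ (fun e => hxy (congrArg Subtype.val e))
  refine ⟨Subtype.val '' {w | w ∈ p.internalVertices}, ?_, ?_, ?_, ?_⟩
  · rintro _ ⟨w, -, rfl⟩
    exact w.2
  · rintro _ ⟨w, hw, rfl⟩
    simpa using hk w hw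
  · rintro _ ⟨w, hw, rfl⟩ _ ⟨w', hw', rfl⟩ heq
    have heq' : c w = c w' := by simpa using heq
    rw [List.inj_on_of_nodup_map hnd hw hw' heq']
  · refine ⟨p.map (Embedding.induce A).toHom, fun z hz => ?_⟩
    replace hz := (Walk.support_map (Embedding.induce A).toHom p) ▸ hz
    rw [List.mem_map] at hz
    obtain ⟨a, ha, rfl⟩ := hz
    rcases mem_internal p ha with rfl | rfl | h
    · right; left; rfl
    · right; right; rfl
    · left; exact ⟨a, h, rfl⟩

end RvcAux

/-- if the connected graph `G` has block decomposition `B₁, …, B_k` and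
exactly `t` cut vertices, then `rvc G ≤ rvc B₁ + ⋯ + rvc B_k + t`. -/
theorem rvc_le_sum_rvc_blocks_add_cutVertices {V : Type*} [Fintype V]
    (G : SimpleGraph V) (hconn : G.Connected) (k t : ℕ) (B : Fin k → Set V)
    (hblock : ∀ i, G.IsBlock (B i)) (hinj : Function.Injective B)
    (hall : ∀ C : Set V, G.IsBlock C → ∃ i, C = B i)
    (hcut : {v | G.IsCutVertex v}.ncard = t) :
    G.rvc ≤ (∑ i, (G.induce (B i)).rvc) + t := by
  classical
  have hcut2 : ∀ i j, i ≠ j → ∀ v, v ∈ B i → v ∈ B j → G.IsCutVertex v :=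
    fun i j hij v hi hj => RvcAux.cut_of_two (hblock i) (hblock j) (fun e => hij (hinj e)) hi hj
  have hE : ∀ u v, G.Adj u v → ∃ i, u ∈ B i ∧ v ∈ B i := by
    intro u v h
    obtain ⟨C, hC, hb⟩ := RvcAux.exists_block (RvcAux.good_edge h)
    obtain ⟨i, rfl⟩ := hall C hb
    exact ⟨i, hC (by simp), hC (by simp)⟩
  have hs := fun i => RvcAux.seg_of_rvcWith
    (RvcAux.rvcWith_rvc (G := G.induce (B i)) (hblock i).1.preconnected)
  choose c hc using hs
  let α := (Σ i : Fin k, Fin (G.induce (B i)).rvc) ⊕ {v // G.IsCutVertex v}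
  have hcard : Fintype.card α = (∑ i, (G.induce (B i)).rvc) + t := by
    simp only [α, Fintype.card_sum, Fintype.card_sigma, Fintype.card_fin]
    congr 1
    rw [← hcut, Set.ncard_eq_toFinset_card', Set.toFinset_card]
    exact Fintype.card_congr (Equiv.refl _)
  let e : α ≃ Fin ((∑ i, (G.induce (B i)).rvc) + t) := Fintype.equivFinOfCardEq hcard
  let col : V → ℕ := fun v =>
    if h : G.IsCutVertex v then (e (Sum.inr ⟨v, h⟩) : ℕ)
    else if h : ∃ i, v ∈ B i ∧ c i v < (G.induce (B i)).rvc then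
      (e (Sum.inl ⟨h.choose, ⟨c h.choose v, h.choose_spec.2⟩⟩) : ℕ) else 0
  have col_cut : ∀ v (h : G.IsCutVertex v), col v = (e (Sum.inr ⟨v, h⟩) : ℕ) :=
    fun v h => by simp only [col, dif_pos h]
  have col_non : ∀ v, ¬ G.IsCutVertex v → (∃ i, v ∈ B i ∧ c i v < (G.induce (B i)).rvc) →
      ∃ i, ∃ h : c i v < (G.induce (B i)).rvc, v ∈ B i ∧
        col v = (e (Sum.inl ⟨i, ⟨c i v, h⟩⟩) : ℕ) :=
    fun v hv h => ⟨h.choose, h.choose_spec.2, h.choose_spec.1, by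
      simp only [col, dif_neg hv, dif_pos h]⟩
  refine Nat.sInf_le ⟨col, fun u v _ => ?_⟩
  obtain ⟨p⟩ := hconn.preconnected u v
  obtain ⟨I, hI⟩ := RvcAux.Ch.exists_of_walk hE p
  obtain ⟨S, hR, ha, hb⟩ := RvcAux.Ch.main (G := G) hcut2 c _ hc hI
  have hcase : ∀ w ∈ S, G.IsCutVertex w ∨ (¬ G.IsCutVertex w ∧
      ∃ i, ∃ h : c i w < (G.induce (B i)).rvc, w ∈ B i ∧
        col w = (e (Sum.inl ⟨i, ⟨c i w, h⟩⟩) : ℕ)) := by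
    intro w hw
    by_cases hwc : G.IsCutVertex w
    · exact Or.inl hwc
    · rcases ha w hw with h | ⟨i, -, h⟩
      · exact absurd h hwc
      · exact Or.inr ⟨hwc, col_non w hwc ⟨i, h⟩⟩
  refine RvcAux.rainbow_of_R (S := S) ?_ ?_ hR
  · intro w hw w' hw' heq
    rcases hcase w hw with h | ⟨hn, i, hi, hwi, h⟩ <;>
      rcases hcase w' hw' with h' | ⟨hn', i', hi', hwi', h'⟩
    · rw [col_cut w h, col_cut w' h'] at heq
      have := e.injective (Fin.ext heq)
      exact congrArg Subtype.val (Sum.inr.inj this)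
    · rw [col_cut w h, h'] at heq
      have := e.injective (Fin.ext heq)
      simp at this
    · rw [h, col_cut w' h'] at heq
      have := e.injective (Fin.ext heq)
      simp at this
    · rw [h, h'] at heq
      have h1 := Sum.inl.inj (e.injective (Fin.ext heq))
      have h2 : i = i' := congrArg Sigma.fst h1
      subst h2
      have h3 : c i w = c i w' := by simpa using h1
      exact hb i w hw w' hw' hn hn' hwi hwi' h3
  · intro w hw
    rcases hcase w hw with h | ⟨hn, i, hi, hwi, h⟩
    · rw [col_cut w h]; exact Fin.is_lt _
    · rw [h]; exact Fin.is_lt _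
end

section
/- Let G be a connected graph whose block decomposition consists of the blocks B_1, B_2, …, B_k, and suppose G has exactly t cut vertices. Then rvc(G) ≤ ⌈|B_1|/2⌉ + ⌈|B_2|/2⌉ + ⋯ + ⌈|B_k|/2⌉ + t, where |B_i| denotes the number of vertices of the block B_i. -/
namespace RVC

open SimpleGraph

/-- `R G S a b`: there is a walk from `a` to `b` in `G` all of whose vertices lie in `S`. -/
def R {V : Type*} (G : SimpleGraph V) (S : Set V) (a b : V) : Prop :=
  ∃ p : G.Walk a b, ∀ x ∈ p.support, x ∈ S

/-- `S` is connected (possibly empty). -/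
def Conn {V : Type*} (G : SimpleGraph V) (S : Set V) : Prop :=
  ∀ a ∈ S, ∀ b ∈ S, R G S a b

section basics
variable {V : Type*} {G : SimpleGraph V} {S T : Set V} {a b c : V}

lemma R.refl (h : a ∈ S) : R G S a a := ⟨.nil, by simpa using h⟩

lemma R.symm (h : R G S a b) : R G S b a := by
  obtain ⟨p, hp⟩ := h
  exact ⟨p.reverse, by simpa using hp⟩

lemma R.trans (h : R G S a b) (h' : R G S b c) : R G S a c := by
  obtain ⟨p, hp⟩ := h
  obtain ⟨q, hq⟩ := h'
  refine ⟨p.append q, fun x hx => ?_⟩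
  rcases (Walk.mem_support_append_iff p q).1 hx with h | h
  · exact hp _ h
  · exact hq _ h

lemma R.mono (h : R G S a b) (hST : S ⊆ T) : R G T a b := by
  obtain ⟨p, hp⟩ := h
  exact ⟨p, fun x hx => hST (hp x hx)⟩

lemma R.left (h : R G S a b) : a ∈ S := by
  obtain ⟨p, hp⟩ := h
  exact hp _ p.start_mem_support

lemma R.right (h : R G S a b) : b ∈ S := h.symm.left

lemma R.adj (ha : a ∈ S) (hb : b ∈ S) (h : G.Adj a b) : R G S a b :=
  ⟨.cons h .nil, by simp [ha, hb]⟩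

/-- First exit from a set `X` along a walk. -/
lemma R.exit (h : R G S a b) {X : Set V} (ha : a ∈ X) (hb : b ∉ X) :
    ∃ x y, x ∈ S ∧ x ∈ X ∧ y ∈ S ∧ y ∉ X ∧ G.Adj x y ∧ R G (S ∩ X) a x := by
  obtain ⟨p, hp⟩ := h
  induction p with
  | nil => exact absurd ha hb
  | @cons u v w huv p ih =>
    have hu : u ∈ S := hp u (by simp)
    have hv : v ∈ S := hp v (by simp)
    by_cases hvX : v ∈ X
    · obtain ⟨x, y, h1, h2, h3, h4, h5, h6⟩ :=
        ih hvX hb (fun x hx => hp x (by simp [hx]))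
      exact ⟨x, y, h1, h2, h3, h4, h5, (R.adj (S := S ∩ X) ⟨hu, ha⟩ ⟨hv, hvX⟩ huv).trans h6⟩
    · exact ⟨u, v, hu, ha, hv, hvX, huv, R.refl ⟨hu, ha⟩⟩

lemma exists_nbr (hS : Conn G S) (ha : a ∈ S) (hb : b ∈ S) (hab : b ≠ a) :
    ∃ x ∈ S, x ≠ a ∧ G.Adj a x := by
  obtain ⟨x, y, h1, h2, h3, h4, h5, h6⟩ := (hS a ha b hb).exit (X := {a}) rfl hab
  obtain rfl : x = a := h2
  exact ⟨y, h3, h4, h5⟩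

/-- Existence of a vertex with property `D` whose removal keeps `S` connected. -/
lemma exists_noncut [Finite V] (D : V → Prop) (hS : Conn G S)
    (hC : ∀ c ∈ S, ∀ a ∈ S, a ≠ c → ∃ z, D z ∧ R G (S \ {c}) a z)
    {c₀ a₀ : V} (hc₀ : c₀ ∈ S) (ha₀ : a₀ ∈ S) (hne : a₀ ≠ c₀) :
    ∃ z ∈ S, z ≠ c₀ ∧ D z ∧ Conn G (S \ {z}) := by
  classical
  let d : V → ℕ := fun w => sInf {n | ∃ p : G.Walk w c₀, (∀ x ∈ p.support, x ∈ S) ∧ p.length = n}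
  have hd : ∀ w ∈ S, ∃ p : G.Walk w c₀, (∀ x ∈ p.support, x ∈ S) ∧ p.length = d w := by
    intro w hw
    obtain ⟨p, hp⟩ := hS w hw c₀ hc₀
    exact Nat.sInf_mem (s := {n | ∃ p : G.Walk w c₀, (∀ x ∈ p.support, x ∈ S) ∧ p.length = n})
      ⟨p.length, p, hp, rfl⟩
  have hd' : ∀ w, ∀ p : G.Walk w c₀, (∀ x ∈ p.support, x ∈ S) → d w ≤ p.length :=
    fun w p hp => Nat.sInf_le ⟨p, hp, rfl⟩
  have hne' : {z | z ∈ S ∧ z ≠ c₀ ∧ D z}.Nonempty := by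
    obtain ⟨z, hz, hr⟩ := hC c₀ hc₀ a₀ ha₀ hne
    exact ⟨z, hr.right.1, hr.right.2, hz⟩
  obtain ⟨z, ⟨hzS, hzc, hzD⟩, hmax⟩ :=
    Set.exists_max_image {z | z ∈ S ∧ z ≠ c₀ ∧ D z} d (Set.toFinite _) hne'
  refine ⟨z, hzS, hzc, hzD, ?_⟩
  have key : ∀ a ∈ S \ {z}, R G (S \ {z}) a c₀ := by
    rintro a ⟨haS, haz⟩
    obtain ⟨w, hwD, hr⟩ := hC z hzS a haS haz
    refine hr.trans ?_
    have hwS := hr.right.1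
    have hwz : w ≠ z := hr.right.2
    obtain ⟨p, hp, hl⟩ := hd w hwS
    refine ⟨p, fun x hx => ⟨hp x hx, ?_⟩⟩
    rintro rfl
    have h1 := hd' x (p.dropUntil x hx)
      (fun y hy => hp y (p.support_dropUntil_subset_support hx hy))
    have h2 : (p.takeUntil x hx).length + (p.dropUntil x hx).length = p.length := by
      rw [← Walk.length_append, Walk.take_spec]
    have h3 : 0 < (p.takeUntil x hx).length := by
      rcases Nat.eq_zero_or_pos (p.takeUntil x hx).length with h | h
      · exact absurd (Walk.eq_of_length_eq_zero h) hwz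
      · exact h
    by_cases hwc : w = c₀
    · subst hwc
      have := hd' w .nil (by simpa using hwS)
      simp at this
      omega
    · have := hmax w ⟨hwS, hwc, hwD⟩
      omega
  intro a ha b hb
  exact (key a ha).trans (key b hb).symm

end basics
section pairing
variable {V : Type*} {G : SimpleGraph V}

/-- Every part of `L` left after removing a vertex has an `E`-edge to `U`. -/
def CC (G : SimpleGraph V) (L U : Set V) (E : V → V → Prop) : Prop :=
  ∀ c ∈ L, ∀ a ∈ L, a ≠ c → ∃ z, (∃ y ∈ U, E z y) ∧ R G (L \ {c}) a z

/-- Vertices of `L` and `U` of different colors are joined by a rainbow walk crossing once. -/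
def Good (G : SimpleGraph V) (L U : Set V) (E : V → V → Prop) (c : V → ℕ) : Prop :=
  ∀ u ∈ L, ∀ v ∈ U, c u ≠ c v → ∃ x y, ∃ P Q : Set V, E x y ∧ P ⊆ L ∧ Q ⊆ U ∧
    R G P u x ∧ R G Q y v ∧ ∀ a ∈ P, ∀ b ∈ Q, c a ≠ c b

lemma CC.mono {L U U' : Set V} {E E' : V → V → Prop} (h : CC G L U E)
    (hE : ∀ x ∈ L, ∀ y ∈ U, E x y → ∃ y' ∈ U', E' x y') : CC G L U' E' := by
  intro c hc a ha hac
  obtain ⟨z, ⟨y, hy, hzy⟩, hr⟩ := h c hc a ha hac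
  exact ⟨z, hE z hr.right.1 y hy hzy, hr⟩

lemma CC.step {L U U' : Set V} {E E' : V → V → Prop} (h : CC G L U E) {p : V}
    (hp : ∃ y ∈ U', E p y)
    (hE : ∀ x ∈ L, x ≠ p → ∀ y ∈ U, E x y → ∃ y' ∈ U', E' x y')
    (hE' : ∀ x y, G.Adj x p → E p y → E' x y) : CC G (L \ {p}) U' E' := by
  rintro c ⟨hcL, hcp⟩ a ⟨haL, hap⟩ hac
  obtain ⟨z, ⟨y, hy, hzy⟩, hr⟩ := h c hcL a haL hac
  by_cases hz : R G ((L \ {p}) \ {c}) a z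
  · exact ⟨z, hE z hz.right.1.1 hz.right.1.2 y hy hzy, hz⟩
  · obtain ⟨x, w, h1, h2, h3, h4, h5, h6⟩ :=
      hr.exit (X := {x | R G ((L \ {p}) \ {c}) a x}) (R.refl ⟨⟨haL, hap⟩, hac⟩) hz
    have h2' : R G ((L \ {p}) \ {c}) a x := h2
    have hwp : w = p := by
      by_contra hne
      exact h4 (h2'.trans (R.adj h2'.right ⟨⟨h3.1, hne⟩, h3.2⟩ h5))
    subst hwp
    obtain ⟨y', hy', hpy⟩ := hp
    exact ⟨x, ⟨y', hy', hE' x y' h5 hpy⟩, h2'⟩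

lemma even_pairing [Finite V] : ∀ (h : ℕ) (L U : Set V) (E : V → V → Prop), L.ncard = h →
    U.ncard = h → Disjoint L U → Conn G L → Conn G U → CC G L U E →
    CC G U L (fun y x => E x y) →
    ∃ c : V → ℕ, (∀ x ∈ L, c x < h) ∧ (∀ x ∈ U, c x < h) ∧ Set.InjOn c L ∧ Set.InjOn c U ∧
      Good G L U E c := by
  classical
  intro h
  induction h with
  | zero =>
    intro L U E hL hU _ _ _ _ _
    rw [Set.ncard_eq_zero] at hL hU
    subst hL hU
    exact ⟨fun _ => 0, by simp, by simp, by simp, by simp, by intro u hu; simp at hu⟩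
  | succ h ih =>
    intro L U E hL hU hdis hLc hUc hCL hCU
    rcases Nat.eq_zero_or_pos h with rfl | hpos
    · obtain ⟨l, rfl⟩ := Set.ncard_eq_one.1 hL
      obtain ⟨r, rfl⟩ := Set.ncard_eq_one.1 hU
      exact ⟨fun _ => 0, by simp, by simp, by simp, by simp, by intro u hu v hv h; simp at h⟩
    obtain ⟨l0, hl0, l1, hl1, hl01⟩ := (Set.one_lt_ncard_iff (Set.toFinite L)).1 (by omega : 1 < L.ncard) |>.imp
      (fun a ⟨b, h1, h2, h3⟩ => (⟨h1, b, h2, h3⟩ : a ∈ L ∧ ∃ b, b ∈ L ∧ a ≠ b))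
    obtain ⟨r0, hr0, r1, hr1, hr01⟩ := (Set.one_lt_ncard_iff (Set.toFinite U)).1 (by omega : 1 < U.ncard) |>.imp
      (fun a ⟨b, h1, h2, h3⟩ => (⟨h1, b, h2, h3⟩ : a ∈ U ∧ ∃ b, b ∈ U ∧ a ≠ b))
    obtain ⟨p1, hp1, hp1n, hp1D, hp1c⟩ :=
      exists_noncut (fun z => ∃ y ∈ U, E z y) hLc hCL hl0 hl1 hl01.symm
    obtain ⟨p2, hp2, hp2n, hp2D, hp2c⟩ :=
      exists_noncut (fun z => ∃ y ∈ U, E z y) hLc hCL hp1 hl0 hp1n.symm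
    obtain ⟨q1, hq1, hq1n, hq1D, hq1c⟩ :=
      exists_noncut (fun z => ∃ y ∈ L, E y z) hUc hCU hr0 hr1 hr01.symm
    obtain ⟨q2, hq2, hq2n, hq2D, hq2c⟩ :=
      exists_noncut (fun z => ∃ y ∈ L, E y z) hUc hCU hq1 hr0 hq1n.symm
    obtain ⟨p, q, hp, hq, hpc, hqc, ⟨y0, hy0, hy0q, hpy0⟩, ⟨x0, hx0, hx0p, hx0q⟩⟩ :
        ∃ p q, p ∈ L ∧ q ∈ U ∧ Conn G (L \ {p}) ∧ Conn G (U \ {q}) ∧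
          (∃ y ∈ U, y ≠ q ∧ E p y) ∧ (∃ x ∈ L, x ≠ p ∧ E x q) := by
      by_cases h1 : ∃ y ∈ U, y ≠ q1 ∧ E p1 y
      · by_cases h2 : ∃ x ∈ L, x ≠ p1 ∧ E x q1
        · exact ⟨p1, q1, hp1, hq1, hp1c, hq1c, h1, h2⟩
        · push Not at h2
          obtain ⟨x, hx, hxq⟩ := hq1D
          obtain ⟨y, hy, hyp⟩ := hp2D
          refine ⟨p2, q1, hp2, hq1, hp2c, hq1c, ⟨y, hy, ?_, hyp⟩, ⟨x, hx, ?_, hxq⟩⟩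
          · rintro rfl; exact h2 p2 hp2 hp2n hyp
          · rintro rfl; exact h2 x hx hp2n hxq
      · push Not at h1
        obtain ⟨x, hx, hxq⟩ := hq2D
        obtain ⟨y, hy, hyp⟩ := hp1D
        refine ⟨p1, q2, hp1, hq2, hp1c, hq2c, ⟨y, hy, ?_, hyp⟩, ⟨x, hx, ?_, hxq⟩⟩
        · rintro rfl; exact h1 y hy hq2n hyp
        · rintro rfl; exact h1 q2 hq2 hq2n hxq
    obtain ⟨p', hp'L, hp'p, hpp'⟩ := exists_nbr hLc hp hx0 hx0p
    obtain ⟨q', hq'U, hq'q, hqq'⟩ := exists_nbr hUc hq hy0 hy0q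
    have hpU : p ∉ U := fun h => Set.disjoint_left.1 hdis hp h
    have hqL : q ∉ L := fun h => Set.disjoint_left.1 hdis h hq
    obtain ⟨c', hcL, hcU, hiL, hiU, hgood⟩ := ih (L \ {p}) (U \ {q})
      (fun x y => E x y ∨ (G.Adj x p ∧ E p y) ∨ (E x q ∧ G.Adj q y))
      (by rw [Set.ncard_sdiff_singleton_of_mem hp]; omega)
      (by rw [Set.ncard_sdiff_singleton_of_mem hq]; omega)
      (hdis.mono Set.sdiff_subset Set.sdiff_subset) hpc hqc
      (hCL.step ⟨y0, ⟨hy0, hy0q⟩, hpy0⟩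
        (by
          intro x hx hxp y hy hxy
          by_cases hyq : y = q
          · subst hyq
            exact ⟨q', ⟨hq'U, hq'q⟩, Or.inr (Or.inr ⟨hxy, hqq'⟩)⟩
          · exact ⟨y, ⟨hy, hyq⟩, Or.inl hxy⟩)
        (fun x y h1 h2 => Or.inr (Or.inl ⟨h1, h2⟩)))
      (hCU.step ⟨x0, ⟨hx0, hx0p⟩, hx0q⟩
        (by
          intro y hy hyq x hx hxy
          by_cases hxp : x = p
          · subst hxp
            exact ⟨p', ⟨hp'L, hp'p⟩, Or.inr (Or.inl ⟨hpp'.symm, hxy⟩)⟩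
          · exact ⟨x, ⟨hx, hxp⟩, Or.inl hxy⟩)
        (fun y x h1 h2 => Or.inr (Or.inr ⟨h2, h1.symm⟩)))
    let c : V → ℕ := fun x => if x = p ∨ x = q then h else c' x
    have hcp : c p = h := by simp [c]
    have hcq : c q = h := by simp [c]
    have hcL' : ∀ x ∈ L, x ≠ p → c x = c' x := by
      intro x hx hxp
      have : x ≠ q := by rintro rfl; exact hqL hx
      simp [c, hxp, this]
    have hcU' : ∀ x ∈ U, x ≠ q → c x = c' x := by
      intro x hx hxp
      have : x ≠ p := by rintro rfl; exact hpU hx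
      simp [c, hxp, this]
    have hltL : ∀ x ∈ L, x ≠ p → c x < h := fun x hx hxp => by
      rw [hcL' x hx hxp]; exact hcL x ⟨hx, hxp⟩
    have hltU : ∀ x ∈ U, x ≠ q → c x < h := fun x hx hxp => by
      rw [hcU' x hx hxp]; exact hcU x ⟨hx, hxp⟩
    refine ⟨c, ?_, ?_, ?_, ?_, ?_⟩
    · intro x hx
      by_cases hxp : x = p
      · rw [hxp, hcp]; omega
      · have := hltL x hx hxp; omega
    · intro x hx
      by_cases hxp : x = q
      · rw [hxp, hcq]; omega
      · have := hltU x hx hxp; omega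
    · intro x hx y hy hxy
      by_cases hxp : x = p <;> by_cases hyp : y = p
      · rw [hxp, hyp]
      · have := hltL y hy hyp; subst hxp; omega
      · have := hltL x hx hxp; subst hyp; omega
      · rw [hcL' x hx hxp, hcL' y hy hyp] at hxy
        exact hiL ⟨hx, hxp⟩ ⟨hy, hyp⟩ hxy
    · intro x hx y hy hxy
      by_cases hxp : x = q <;> by_cases hyp : y = q
      · rw [hxp, hyp]
      · have := hltU y hy hyp; subst hxp; omega
      · have := hltU x hx hxp; subst hyp; omega
      · rw [hcU' x hx hxp, hcU' y hy hyp] at hxy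
        exact hiU ⟨hx, hxp⟩ ⟨hy, hyp⟩ hxy
    · intro u hu v hv huv
      by_cases hup : u = p
      · subst hup
        have hvq : v ≠ q := by rintro rfl; exact huv (hcp.trans hcq.symm)
        refine ⟨u, y0, {u}, U \ {q}, hpy0, by simpa using hu, Set.sdiff_subset, R.refl rfl,
          hqc _ ⟨hy0, hy0q⟩ _ ⟨hv, hvq⟩, ?_⟩
        rintro a rfl b ⟨hb, hbq⟩
        have := hltU b hb hbq
        omega
      by_cases hvq : v = q
      · subst hvq
        refine ⟨x0, v, L \ {p}, {v}, hx0q, Set.sdiff_subset, by simpa using hv,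
          hpc _ ⟨hu, hup⟩ _ ⟨hx0, hx0p⟩, R.refl rfl, ?_⟩
        rintro a ⟨ha, hap⟩ b rfl
        have := hltL a ha hap
        omega
      rw [hcL' u hu hup, hcU' v hv hvq] at huv
      obtain ⟨x, y, P, Q, hE, hPL, hQU, hP, hQ, hPQ⟩ := hgood u ⟨hu, hup⟩ v ⟨hv, hvq⟩ huv
      have hPQ' : ∀ a ∈ P, ∀ b ∈ Q, c a ≠ c b := by
        intro a ha b hb
        rw [hcL' a (hPL ha).1 (hPL ha).2, hcU' b (hQU hb).1 (hQU hb).2]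
        exact hPQ a ha b hb
      have hPL' := hPL.trans Set.sdiff_subset
      have hQU' := hQU.trans Set.sdiff_subset
      rcases hE with hE | ⟨hxp, hpy⟩ | ⟨hxq, hqy⟩
      · exact ⟨x, y, P, Q, hE, hPL', hQU', hP, hQ, hPQ'⟩
      · refine ⟨p, y, insert p P, Q, hpy, Set.insert_subset hp hPL', hQU',
          (hP.mono (Set.subset_insert _ _)).trans
            (R.adj (Or.inr hP.right) (Or.inl rfl) hxp), hQ, ?_⟩
        rintro a (rfl | ha) b hb
        · have := hltU b (hQU hb).1 (hQU hb).2
          omega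
        · exact hPQ' a ha b hb
      · refine ⟨x, q, P, insert q Q, hxq, hPL', Set.insert_subset hq hQU', hP,
          (R.adj (S := insert q Q) (Or.inl rfl) (Or.inr hQ.left) hqy).trans
            (hQ.mono (Set.subset_insert _ _)), ?_⟩
        rintro a ha b (rfl | hb)
        · have := hltL a (hPL ha).1 (hPL ha).2
          omega
        · exact hPQ' a ha b hb

lemma odd_pairing [Finite V] (h : ℕ) (L U : Set V) (E : V → V → Prop) (hpos : 0 < h)
    (hL : L.ncard = h + 1)
    (hU : U.ncard = h) (hdis : Disjoint L U) (hLc : Conn G L) (hUc : Conn G U) (hCL : CC G L U E)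
    (hCU : CC G U L (fun y x => E x y)) :
    ∃ c : V → ℕ, (∀ x ∈ L, c x < h + 1) ∧ (∀ x ∈ U, c x < h + 1) ∧ Set.InjOn c L ∧
      Set.InjOn c U ∧ Good G L U E c := by
  classical
  obtain ⟨l0, hl0, l1, hl1, hl01⟩ := (Set.one_lt_ncard_iff (Set.toFinite L)).1 (by omega : 1 < L.ncard) |>.imp
    (fun a ⟨b, h1, h2, h3⟩ => (⟨h1, b, h2, h3⟩ : a ∈ L ∧ ∃ b, b ∈ L ∧ a ≠ b))
  obtain ⟨p, hp, hpn, ⟨y0, hy0, hpy0⟩, hpc⟩ :=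
    exists_noncut (fun z => ∃ y ∈ U, E z y) hLc hCL hl0 hl1 hl01.symm
  obtain ⟨p', hp'L, hp'p, hpp'⟩ := exists_nbr hLc hp hl0 hpn.symm
  have hpU : p ∉ U := fun h => Set.disjoint_left.1 hdis hp h
  obtain ⟨c', hcL, hcU, hiL, hiU, hgood⟩ := even_pairing h (L \ {p}) U
    (fun x y => E x y ∨ (G.Adj x p ∧ E p y))
    (by rw [Set.ncard_sdiff_singleton_of_mem hp]; omega) hU
    (hdis.mono_left Set.sdiff_subset) hpc hUc
    (hCL.step ⟨y0, hy0, hpy0⟩ (fun x hx hxp y hy hxy => ⟨y, hy, Or.inl hxy⟩)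
      (fun x y h1 h2 => Or.inr ⟨h1, h2⟩))
    (hCU.mono
      (by
        intro y hy x hx hxy
        by_cases hxp : x = p
        · subst hxp
          exact ⟨p', ⟨hp'L, hp'p⟩, Or.inr ⟨hpp'.symm, hxy⟩⟩
        · exact ⟨x, ⟨hx, hxp⟩, Or.inl hxy⟩))
  let c : V → ℕ := fun x => if x = p then h else c' x
  have hcp : c p = h := by simp [c]
  have hcL' : ∀ x, x ≠ p → c x = c' x := by
    intro x hxp
    simp [c, hxp]
  have hcU' : ∀ x ∈ U, c x = c' x := by
    intro x hx
    exact hcL' x (by rintro rfl; exact hpU hx)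
  have hltL : ∀ x ∈ L, x ≠ p → c x < h := fun x hx hxp => by
    rw [hcL' x hxp]; exact hcL x ⟨hx, hxp⟩
  have hltU : ∀ x ∈ U, c x < h := fun x hx => by
    rw [hcU' x hx]; exact hcU x hx
  refine ⟨c, ?_, ?_, ?_, ?_, ?_⟩
  · intro x hx
    by_cases hxp : x = p
    · rw [hxp, hcp]; omega
    · have := hltL x hx hxp; omega
  · intro x hx
    have := hltU x hx; omega
  · intro x hx y hy hxy
    by_cases hxp : x = p <;> by_cases hyp : y = p
    · rw [hxp, hyp]
    · have := hltL y hy hyp; subst hxp; omega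
    · have := hltL x hx hxp; subst hyp; omega
    · rw [hcL' x hxp, hcL' y hyp] at hxy
      exact hiL ⟨hx, hxp⟩ ⟨hy, hyp⟩ hxy
  · intro x hx y hy hxy
    rw [hcU' x hx, hcU' y hy] at hxy
    exact hiU hx hy hxy
  · intro u hu v hv huv
    by_cases hup : u = p
    · subst hup
      refine ⟨u, y0, {u}, U, hpy0, by simpa using hu, subset_rfl, R.refl rfl,
        hUc _ hy0 _ hv, ?_⟩
      rintro a rfl b hb
      have := hltU b hb
      omega
    rw [hcL' u hup, hcU' v hv] at huv
    obtain ⟨x, y, P, Q, hE, hPL, hQU, hP, hQ, hPQ⟩ := hgood u ⟨hu, hup⟩ v hv huv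
    have hPQ' : ∀ a ∈ P, ∀ b ∈ Q, c a ≠ c b := by
      intro a ha b hb
      rw [hcL' a (hPL ha).2, hcU' b (hQU hb)]
      exact hPQ a ha b hb
    have hPL' := hPL.trans Set.sdiff_subset
    rcases hE with hE | ⟨hxp, hpy⟩
    · exact ⟨x, y, P, Q, hE, hPL', hQU, hP, hQ, hPQ'⟩
    · refine ⟨p, y, insert p P, Q, hpy, Set.insert_subset hp hPL', hQU,
        (hP.mono (Set.subset_insert _ _)).trans
          (R.adj (Or.inr hP.right) (Or.inl rfl) hxp), hQ, ?_⟩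
      rintro a (rfl | ha) b hb
      · have := hltU b (hQU hb)
        omega
      · exact hPQ' a ha b hb

end pairing
section blocks
variable {V : Type*} {G : SimpleGraph V}

lemma CC_of_two_conn {B U L : Set V} (hB2 : ∀ c ∈ B, Conn G (B \ {c})) (hUB : U ⊆ B)
    (hLB : L ⊆ B) (hdis : Disjoint L U) (hcov : ∀ x ∈ B, x ∉ U → x ∈ L) (hne : L.Nonempty) :
    CC G U L G.Adj := by
  intro c hc a ha hac
  obtain ⟨l, hl⟩ := hne
  have hlU : l ∉ U := Set.disjoint_left.1 hdis hl
  have hlc : l ≠ c := by rintro rfl; exact hlU hc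
  obtain ⟨x, y, h1, h2, h3, h4, h5, h6⟩ :=
    (hB2 c (hUB hc) a ⟨hUB ha, hac⟩ l ⟨hLB hl, hlc⟩).exit (X := U) ha hlU
  exact ⟨x, ⟨y, hcov y h3.1 h4, h5⟩, h6.mono (fun t ht => ⟨ht.2, ht.1.2⟩)⟩

lemma exists_partition [Finite V] {B : Set V} (hB2 : ∀ c ∈ B, Conn G (B \ {c})) :
    ∀ k, 0 < k → k < B.ncard → ∃ L ⊆ B, L.ncard = k ∧ Conn G L ∧ Conn G (B \ L) := by
  intro k
  induction k with
  | zero => intro h; omega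
  | succ k ih =>
    intro _ hk
    rcases Nat.eq_zero_or_pos k with rfl | hpos
    · obtain ⟨b, hb⟩ : B.Nonempty := by
        rw [← Set.ncard_pos (Set.toFinite B)]; omega
      refine ⟨{b}, by simpa using hb, by simp, ?_, hB2 b hb⟩
      rintro x rfl y rfl
      exact R.refl rfl
    · obtain ⟨L, hLB, hLk, hLc, hUc⟩ := ih hpos (by omega)
      have hcard : (B \ L).ncard = B.ncard - k := by
        rw [Set.ncard_sdiff hLB (Set.toFinite L), hLk]
      have hLne : L.Nonempty := by
        rw [← Set.ncard_pos (Set.toFinite L)]; omega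
      obtain ⟨l0, l1, hl0, hl1, hl01⟩ :=
        (Set.one_lt_ncard_iff (Set.toFinite (B \ L))).1 (by omega)
      have hdis : Disjoint L (B \ L) := Set.disjoint_sdiff_right
      have hCC : CC G (B \ L) L G.Adj := CC_of_two_conn hB2 Set.sdiff_subset hLB hdis
        (fun x hx hxU => by by_contra h; exact hxU ⟨hx, h⟩) hLne
      obtain ⟨z, hz, -, ⟨y, hy, hzy⟩, hzc⟩ :=
        exists_noncut (fun z => ∃ y ∈ L, G.Adj z y) hUc hCC hl0 hl1 hl01.symm
      refine ⟨insert z L, Set.insert_subset hz.1 hLB, ?_, ?_, ?_⟩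
      · rw [Set.ncard_insert_of_notMem hz.2 (Set.toFinite L), hLk]
      · have key : ∀ a ∈ insert z L, R G (insert z L) a y := by
          rintro a (rfl | ha)
          · exact R.adj (Or.inl rfl) (Or.inr hy) hzy
          · exact (hLc a ha y hy).mono (Set.subset_insert _ _)
        intro a ha b hb
        exact (key a ha).trans (key b hb).symm
      · have : B \ insert z L = (B \ L) \ {z} := by
          ext t; simp only [Set.mem_sdiff, Set.mem_insert_iff, Set.mem_singleton_iff]; tauto
        rw [this]; exact hzc

/-- The coloring of a single block. -/
lemma block_coloring [Finite V] {B : Set V} (hB : Conn G B)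
    (hB2 : ∀ c ∈ B, Conn G (B \ {c})) :
    ∃ c : V → ℕ, (∀ x ∈ B, c x < (B.ncard + 1) / 2) ∧ ∀ u ∈ B, ∀ v ∈ B, u ≠ v →
      ∃ S ⊆ B, R G S u v ∧ ∀ x ∈ S, ∀ y ∈ S, x ≠ u → x ≠ v → y ≠ u → y ≠ v →
        c x = c y → x = y := by
  classical
  rcases Nat.lt_or_ge B.ncard 2 with hn | hn
  · refine ⟨fun _ => 0, ?_, ?_⟩
    · intro x hx
      have : 0 < B.ncard := (Set.ncard_pos (Set.toFinite B)).2 ⟨x, hx⟩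
      show 0 < _
      omega
    · intro u hu v hv huv
      have := (Set.one_lt_ncard_iff (Set.toFinite B)).2 ⟨u, v, hu, hv, huv⟩
      omega
  obtain ⟨U, hUB, hUk, hUc, hLc⟩ := exists_partition hB2 (B.ncard / 2) (by omega) (by omega)
  have hLcard : (B \ U).ncard = B.ncard - B.ncard / 2 := by
    rw [Set.ncard_sdiff hUB (Set.toFinite U), hUk]
  have hdis : Disjoint (B \ U) U := Set.disjoint_sdiff_left
  have hUne : U.Nonempty := by
    rw [← Set.ncard_pos (Set.toFinite U)]; omega
  have hLne : (B \ U).Nonempty := by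
    rw [← Set.ncard_pos (Set.toFinite _)]; omega
  have hCL : CC G (B \ U) U G.Adj := CC_of_two_conn hB2 Set.sdiff_subset hUB hdis.symm
    (fun x hx hxU => by by_contra h; exact hxU ⟨hx, h⟩) hUne
  have hCU : CC G U (B \ U) (fun y x => G.Adj x y) := by
    have := CC_of_two_conn hB2 hUB Set.sdiff_subset hdis (fun x hx hxU => ⟨hx, hxU⟩) hLne
    exact this.mono (fun x _ y hy h => ⟨y, hy, h.symm⟩)
  obtain ⟨c, hcL, hcU, hiL, hiU, hgood⟩ : ∃ c : V → ℕ, (∀ x ∈ B \ U, c x < (B.ncard + 1) / 2) ∧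
      (∀ x ∈ U, c x < (B.ncard + 1) / 2) ∧ Set.InjOn c (B \ U) ∧ Set.InjOn c U ∧
      Good G (B \ U) U G.Adj c := by
    rcases Nat.even_or_odd' B.ncard with ⟨m, hm | hm⟩
    · have h1 : (B.ncard + 1) / 2 = m := by omega
      rw [h1]
      exact even_pairing m (B \ U) U G.Adj (by omega) (by omega) hdis hLc hUc hCL hCU
    · have h1 : (B.ncard + 1) / 2 = m + 1 := by omega
      rw [h1]
      exact odd_pairing m (B \ U) U G.Adj (by omega) (by omega) (by omega) hdis hLc hUc hCL hCU
  -- closed rainbow walks between vertices of different colors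
  have hmain : ∀ u ∈ B, ∀ v ∈ B, c u ≠ c v → ∃ S ⊆ B, R G S u v ∧ Set.InjOn c S := by
    have cross : ∀ u ∈ B \ U, ∀ v ∈ U, c u ≠ c v → ∃ S ⊆ B, R G S u v ∧ Set.InjOn c S := by
      intro u hu v hv huv
      obtain ⟨x, y, P, Q, hE, hPL, hQU, hP, hQ, hPQ⟩ := hgood u hu v hv huv
      refine ⟨P ∪ Q, Set.union_subset (hPL.trans Set.sdiff_subset) (hQU.trans hUB),
        ((hP.mono Set.subset_union_left).trans
          (R.adj (Or.inl hP.right) (Or.inr hQ.left) hE)).trans (hQ.mono Set.subset_union_right), ?_⟩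
      rintro a (ha | ha) b (hb | hb) hab
      · exact hiL (hPL ha) (hPL hb) hab
      · exact absurd hab (hPQ a ha b hb)
      · exact absurd hab.symm (hPQ b hb a ha)
      · exact hiU (hQU ha) (hQU hb) hab
    intro u hu v hv huv
    by_cases huU : u ∈ U <;> by_cases hvU : v ∈ U
    · exact ⟨U, hUB, hUc u huU v hvU, hiU⟩
    · obtain ⟨S, h1, h2, h3⟩ := cross v ⟨hv, hvU⟩ u huU huv.symm
      exact ⟨S, h1, h2.symm, h3⟩
    · exact cross u ⟨hu, huU⟩ v hvU huv
    · exact ⟨B \ U, Set.sdiff_subset, hLc u ⟨hu, huU⟩ v ⟨hv, hvU⟩, hiL⟩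
  refine ⟨c, fun x hx => ?_, ?_⟩
  · by_cases hxU : x ∈ U
    · exact hcU x hxU
    · exact hcL x ⟨hx, hxU⟩
  · intro u hu v hv huv
    by_cases hc : c u = c v
    · obtain ⟨w, hw, hwv, hvw⟩ := exists_nbr hB hv hu huv
      obtain ⟨S, hSB, hS, hinj⟩ : ∃ S ⊆ B, R G S u w ∧ Set.InjOn c S := by
        by_cases hcw : c u = c w
        · by_cases huw : u = w
          · subst huw
            exact ⟨{u}, by simpa using hu, R.refl rfl, by simp⟩
          · -- three vertices of the same color are impossible
            exfalso
            have hvw' : c v = c w := hc ▸ hcw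
            by_cases h1 : u ∈ U <;> by_cases h2 : v ∈ U <;> by_cases h3 : w ∈ U
            · exact huv (hiU h1 h2 hc)
            · exact huv (hiU h1 h2 hc)
            · exact huw (hiU h1 h3 hcw)
            · exact hwv (hiL ⟨hw, h3⟩ ⟨hv, h2⟩ hvw'.symm)
            · exact hwv (hiU h3 h2 hvw'.symm)
            · exact huw (hiL ⟨hu, h1⟩ ⟨hw, h3⟩ hcw)
            · exact huv (hiL ⟨hu, h1⟩ ⟨hv, h2⟩ hc)
            · exact huv (hiL ⟨hu, h1⟩ ⟨hv, h2⟩ hc)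
        · exact hmain u hu w hw hcw
      refine ⟨insert v S, Set.insert_subset hv hSB, (hS.mono (Set.subset_insert _ _)).trans
        (R.adj (Or.inr hS.right) (Or.inl rfl) hvw.symm), ?_⟩
      rintro x (rfl | hx) y (rfl | hy) h1 h2 h3 h4 hxy
      · rfl
      · exact absurd rfl h2
      · exact absurd rfl h4
      · exact hinj hx hy hxy
    · obtain ⟨S, hSB, hS, hinj⟩ := hmain u hu v hv hc
      exact ⟨S, hSB, hS, fun x hx y hy _ _ _ _ hxy => hinj hx hy hxy⟩

end blocks
section combine
variable {V : Type*} {G : SimpleGraph V}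

lemma R_induce {B : Set V} {T : Set B} {a b : B} :
    R (G.induce B) T a b ↔ R G (Set.image Subtype.val T) a.1 b.1 := by
  constructor
  · rintro ⟨p, hp⟩
    induction p with
    | @nil u => exact R.refl ⟨u, hp u (by simp), rfl⟩
    | @cons u v w huv p ih =>
      exact (R.adj (S := Set.image Subtype.val T) ⟨u, hp u (by simp), rfl⟩ ⟨v, hp v (by simp), rfl⟩
        huv).trans (ih (fun x hx => hp x (by simp [hx])))
  · rintro ⟨p, hp⟩
    obtain ⟨a, ha⟩ := a
    obtain ⟨b, hb⟩ := b
    have aux : ∀ (u w : V) (p : G.Walk u w) (hu : u ∈ B) (hw : w ∈ B),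
        (∀ x ∈ p.support, x ∈ Set.image Subtype.val T) → R (G.induce B) T ⟨u, hu⟩ ⟨w, hw⟩ := by
      intro u w p
      induction p with
      | @nil u =>
        intro hu hw h
        obtain ⟨y, hy, hyu⟩ := h u (by simp)
        have : y = ⟨_, hu⟩ := Subtype.ext hyu
        exact R.refl (this ▸ hy)
      | @cons u v w huv p ih =>
        intro hu hw h
        obtain ⟨y, hy, hyu⟩ := h u (by simp)
        obtain ⟨z, hz, hzv⟩ := h v (by simp)
        have hv : v ∈ B := hzv ▸ z.2
        have h1 : y = ⟨_, hu⟩ := Subtype.ext hyu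
        have h2 : z = ⟨_, hv⟩ := Subtype.ext hzv
        refine (R.adj (h1 ▸ hy) (h2 ▸ hz) ?_).trans
          (ih hv hw (fun x hx => h x (by simp [hx])))
        exact huv
    exact aux a b p ha hb hp

lemma preconnected_iff {S : Set V} : (G.induce S).Preconnected ↔ Conn G S := by
  have key : ∀ a b : S, (G.induce S).Reachable a b ↔ R G S a.1 b.1 := by
    intro a b
    have := R_induce (G := G) (B := S) (T := Set.univ) (a := a) (b := b)
    rw [Set.image_univ, Subtype.range_coe] at this
    rw [← this]
    exact ⟨fun ⟨p⟩ => ⟨p, by simp⟩, fun ⟨p, _⟩ => ⟨p⟩⟩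
  exact ⟨fun h a ha b hb => (key ⟨a, ha⟩ ⟨b, hb⟩).1 (h _ _),
    fun h a b => (key a b).2 (h _ a.2 _ b.2)⟩

lemma not_cut_iff {v : V} : ¬ G.IsCutVertex v ↔ Conn G {u | u ≠ v} := by
  rw [SimpleGraph.IsCutVertex, not_not, preconnected_iff]

lemma not_cut_induce_iff {B : Set V} {v : B} :
    ¬ (G.induce B).IsCutVertex v ↔ Conn G (B \ {v.1}) := by
  have himg : (Set.image Subtype.val {u : B | u ≠ v}) = B \ {v.1} := by
    ext x
    constructor
    · rintro ⟨y, hy, rfl⟩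
      exact ⟨y.2, fun h => hy (Subtype.ext h)⟩
    · rintro ⟨hx, hxv⟩
      exact ⟨⟨x, hx⟩, fun h => hxv (congrArg Subtype.val h), rfl⟩
  rw [not_cut_iff]
  constructor
  · intro h a ha b hb
    have := h ⟨a, ha.1⟩ (fun h => ha.2 (congrArg Subtype.val h))
      ⟨b, hb.1⟩ (fun h => hb.2 (congrArg Subtype.val h))
    rwa [R_induce, himg] at this
  · intro h a ha b hb
    rw [R_induce, himg]
    exact h _ ⟨a.2, fun h => ha (Subtype.ext h)⟩ _ ⟨b.2, fun h => hb (Subtype.ext h)⟩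

/-- Nonempty, connected, without cut vertex. -/
def Nice (G : SimpleGraph V) (B : Set V) : Prop :=
  B.Nonempty ∧ Conn G B ∧ ∀ c ∈ B, Conn G (B \ {c})

lemma nice_iff {B : Set V} : Nice G B ↔
    (G.induce B).Connected ∧ ∀ v, ¬ (G.induce B).IsCutVertex v := by
  constructor
  · rintro ⟨⟨b, hb⟩, h1, h2⟩
    have : Nonempty B := ⟨⟨b, hb⟩⟩
    exact ⟨⟨preconnected_iff.2 h1⟩, fun v => not_cut_induce_iff.2 (h2 v v.2)⟩
  · rintro ⟨h1, h2⟩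
    obtain ⟨b⟩ := h1.nonempty
    exact ⟨⟨b, b.2⟩, preconnected_iff.1 h1.preconnected,
      fun c hc => not_cut_induce_iff.1 (h2 ⟨c, hc⟩)⟩

lemma isBlock_iff {B : Set V} : G.IsBlock B ↔ Nice G B ∧ ∀ C, B ⊆ C → Nice G C → C = B := by
  unfold SimpleGraph.IsBlock
  constructor
  · rintro ⟨h1, h2, h3⟩
    exact ⟨nice_iff.2 ⟨h1, h2⟩, fun C hC hN => h3 C hC (nice_iff.1 hN).1 (nice_iff.1 hN).2⟩
  · rintro ⟨h1, h2⟩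
    exact ⟨(nice_iff.1 h1).1, (nice_iff.1 h1).2, fun C hC h3 h4 => h2 C hC (nice_iff.2 ⟨h3, h4⟩)⟩

lemma exists_block [Finite V] {A : Set V} (hA : Nice G A) : ∃ B, A ⊆ B ∧ G.IsBlock B := by
  obtain ⟨B, hAB, hB⟩ := (Set.toFinite {C : Set V | Nice G C}).exists_le_maximal hA
  exact ⟨B, hAB, isBlock_iff.2 ⟨hB.prop, fun C hBC hC => (hB.eq_of_le hC hBC).symm⟩⟩

lemma conn_subsingleton {S : Set V} (h : S.Subsingleton) : Conn G S := by
  intro a ha b hb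
  obtain rfl := h ha hb
  exact R.refl ha

lemma nice_singleton (a : V) : Nice G {a} :=
  ⟨⟨a, rfl⟩, conn_subsingleton Set.subsingleton_singleton,
    fun _ _ => conn_subsingleton (Set.subsingleton_singleton.anti Set.sdiff_subset)⟩

lemma nice_pair {a b : V} (h : G.Adj a b) : Nice G {a, b} := by
  refine ⟨⟨a, Or.inl rfl⟩, ?_, ?_⟩
  · have h1 : R G {a, b} a b := R.adj (Or.inl rfl) (Or.inr rfl) h
    rintro x (rfl | rfl) y (rfl | rfl)
    · exact R.refl (Or.inl rfl)
    · exact h1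
    · exact h1.symm
    · exact R.refl (Or.inr rfl)
  · rintro c hc
    apply conn_subsingleton
    rintro x ⟨hx, hxc⟩ y ⟨hy, hyc⟩
    simp only [Set.mem_insert_iff, Set.mem_singleton_iff] at *
    grind

lemma cut_of_two_blocks {B₀ B₁ : Set V} (h0 : G.IsBlock B₀) (h1 : G.IsBlock B₁)
    (hne : B₀ ≠ B₁) {x : V} (hx0 : x ∈ B₀) (hx1 : x ∈ B₁) : G.IsCutVertex x := by
  classical
  by_contra hcut
  rw [not_cut_iff] at hcut
  rw [isBlock_iff] at h0 h1
  obtain ⟨⟨-, hc0, hd0⟩, hm0⟩ := h0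
  obtain ⟨hn1, hm1⟩ := h1
  have hn0' : ¬ B₁ ⊆ B₀ := fun h => hne (hm1 B₀ h ⟨⟨x, hx0⟩, hc0, hd0⟩)
  have hn1' : ¬ B₀ ⊆ B₁ := fun h => hne (hm0 B₁ h hn1).symm
  obtain ⟨-, hc1, hd1⟩ := hn1
  obtain ⟨b0, hb0, hb01⟩ := Set.not_subset.1 hn1'
  obtain ⟨b1, hb1, hb10⟩ := Set.not_subset.1 hn0'
  have hb0x : b0 ≠ x := by rintro rfl; exact hb01 hx1
  have hb1x : b1 ≠ x := by rintro rfl; exact hb10 hx0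
  obtain ⟨w, hw⟩ := hcut b0 hb0x b1 hb1x
  obtain ⟨p, hpath, hp⟩ : ∃ p : G.Walk b0 b1, p.IsPath ∧ ∀ y ∈ p.support, y ≠ x :=
    ⟨w.bypass, w.bypass_isPath, fun y hy => hw y (w.support_bypass_subset_support hy)⟩
  let C : Set V := (B₀ ∪ B₁) ∪ {y | y ∈ p.support}
  have hB0C : B₀ ⊆ C := fun y hy => Or.inl (Or.inl hy)
  have hB1C : B₁ ⊆ C := fun y hy => Or.inl (Or.inr hy)
  have hPC : ∀ y ∈ p.support, y ∈ C := fun y hy => Or.inr hy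
  have conn_of : ∀ (S : Set V) (r : V), (∀ a ∈ S, R G S a r) → Conn G S :=
    fun S r h a ha b hb => (h a ha).trans (h b hb).symm
  have htake : ∀ y (hy : y ∈ p.support), ∀ S : Set V, (∀ z ∈ (p.takeUntil y hy).support, z ∈ S) →
      R G S y b0 := fun y hy S h => R.symm ⟨p.takeUntil y hy, h⟩
  have hsubt : ∀ y (hy : y ∈ p.support), ∀ z ∈ (p.takeUntil y hy).support, z ∈ p.support :=
    fun y hy z hz => p.support_takeUntil_subset_support hy hz
  have hsubd : ∀ y (hy : y ∈ p.support), ∀ z ∈ (p.dropUntil y hy).support, z ∈ p.support :=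
    fun y hy z hz => p.support_dropUntil_subset_support hy hz
  have hC : Nice G C := by
    refine ⟨⟨x, hB0C hx0⟩, conn_of C x ?_, ?_⟩
    · rintro a ((ha | ha) | ha)
      · exact (hc0 a ha x hx0).mono hB0C
      · exact (hc1 a ha x hx1).mono hB1C
      · exact (htake a ha C (fun z hz => hPC z (hsubt a ha z hz))).trans
          ((hc0 b0 hb0 x hx0).mono hB0C)
    · intro c hc
      have s0 : B₀ \ {c} ⊆ C \ {c} := Set.sdiff_subset_sdiff_left hB0C
      have s1 : B₁ \ {c} ⊆ C \ {c} := Set.sdiff_subset_sdiff_left hB1C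
      have hd0' : Conn G (B₀ \ {c}) := by
        by_cases h : c ∈ B₀
        · exact hd0 c h
        · rwa [Set.sdiff_singleton_eq_self h]
      have hd1' : Conn G (B₁ \ {c}) := by
        by_cases h : c ∈ B₁
        · exact hd1 c h
        · rwa [Set.sdiff_singleton_eq_self h]
      by_cases hcx : c = x
      · subst hcx
        have hb10' : R G (C \ {c}) b1 b0 := htake b1 p.end_mem_support _
          (fun z hz => ⟨hPC z (hsubt _ _ z hz), hp z (hsubt _ _ z hz)⟩)
        apply conn_of _ b0
        rintro a ⟨(ha | ha) | ha, hac⟩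
        · exact (hd0' a ⟨ha, hac⟩ b0 ⟨hb0, hb0x⟩).mono s0
        · exact ((hd1' a ⟨ha, hac⟩ b1 ⟨hb1, hb1x⟩).mono s1).trans hb10'
        · exact htake a ha _ (fun z hz => ⟨hPC z (hsubt a ha z hz), hp z (hsubt a ha z hz)⟩)
      · have hxc : x ∉ ({c} : Set V) := fun h => hcx h.symm
        apply conn_of _ x
        rintro a ⟨(ha | ha) | ha, hac⟩
        · exact (hd0' a ⟨ha, hac⟩ x ⟨hx0, hxc⟩).mono s0
        · exact (hd1' a ⟨ha, hac⟩ x ⟨hx1, hxc⟩).mono s1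
        · by_cases hct : c ∈ (p.takeUntil a ha).support
          · have hcd : c ∉ (p.dropUntil a ha).support := by
              intro hcd
              have hnd := hpath.support_nodup
              rw [← p.take_spec ha, Walk.support_append] at hnd
              have hcd' : c ∈ (p.dropUntil a ha).support.tail := by
                rw [← Walk.cons_tail_support] at hcd
                rcases List.mem_cons.1 hcd with h | h
                · exact absurd h.symm hac
                · exact h
              exact List.disjoint_of_nodup_append hnd hct hcd'
            have h1 : R G (C \ {c}) a b1 := ⟨p.dropUntil a ha, fun z hz =>
              ⟨hPC z (hsubd a ha z hz), fun h => hcd (h ▸ hz)⟩⟩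
            exact h1.trans ((hd1' b1 ⟨hb1, h1.right.2⟩ x ⟨hx1, hxc⟩).mono s1)
          · have h1 : R G (C \ {c}) a b0 := htake a ha _ (fun z hz =>
              ⟨hPC z (hsubt a ha z hz), fun h => hct (h ▸ hz)⟩)
            exact h1.trans ((hd0' b0 ⟨hb0, h1.right.2⟩ x ⟨hx0, hxc⟩).mono s0)
  have := hm0 C hB0C hC
  exact hb10 (this ▸ hB1C hb1)

/-- Combining the block colorings. -/
lemma combine [Finite V] (hconn : G.Connected) {k : ℕ} (B : Fin k → Set V)
    (hblock : ∀ i, G.IsBlock (B i)) (hinj : Function.Injective B)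
    (hall : ∀ C : Set V, G.IsBlock C → ∃ i, C = B i) {K : Type*} (γ : V → K) (f : Fin k → V → ℕ)
    (hf : ∀ i, ∀ u ∈ B i, ∀ v ∈ B i, u ≠ v →
      ∃ S ⊆ B i, R G S u v ∧ ∀ x ∈ S, ∀ y ∈ S, x ≠ u → x ≠ v → y ≠ u → y ≠ v →
        f i x = f i y → x = y)
    (hcut : ∀ x y, G.IsCutVertex x → γ x = γ y → x = y)
    (hnon : ∀ x y, ¬ G.IsCutVertex x → ¬ G.IsCutVertex y → γ x = γ y →
      ∃ i, x ∈ B i ∧ y ∈ B i ∧ f i x = f i y) (u v : V) (huv : u ≠ v) :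
    ∃ S, R G S u v ∧ ∀ x ∈ S, ∀ y ∈ S, x ≠ u → x ≠ v → y ≠ u → y ≠ v → γ x = γ y → x = y := by
  have huniq : ∀ x i j, ¬ G.IsCutVertex x → x ∈ B i → x ∈ B j → i = j := by
    intro x i j hx hi hj
    by_contra hij
    exact hx (cut_of_two_blocks (hblock i) (hblock j) (fun h => hij (hinj h)) hi hj)
  let H : SimpleGraph V := SimpleGraph.fromRel (fun x y => ∃ i, x ∈ B i ∧ y ∈ B i)
  have hHadj : ∀ x y, H.Adj x y ↔ x ≠ y ∧ ∃ i, x ∈ B i ∧ y ∈ B i := by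
    intro x y
    simp only [H, SimpleGraph.fromRel_adj]
    constructor
    · rintro ⟨h, ⟨i, h1, h2⟩ | ⟨i, h1, h2⟩⟩
      · exact ⟨h, i, h1, h2⟩
      · exact ⟨h, i, h2, h1⟩
    · rintro ⟨h, i, h1, h2⟩
      exact ⟨h, Or.inl ⟨i, h1, h2⟩⟩
  have hGH : G ≤ H := by
    intro x y hxy
    obtain ⟨C, hC, hb⟩ := exists_block (nice_pair hxy)
    obtain ⟨i, rfl⟩ := hall C hb
    exact (hHadj x y).2 ⟨hxy.ne, i, hC (Or.inl rfl), hC (Or.inr rfl)⟩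
  have hHc : H.Connected := hconn.mono hGH
  let d : V → ℕ := fun w => H.dist w v
  have hdle : ∀ i x y, x ∈ B i → y ∈ B i → d x ≤ d y + 1 := by
    intro i x y hx hy
    by_cases hxy : x = y
    · subst hxy; omega
    · have h1 : H.Adj x y := (hHadj x y).2 ⟨hxy, i, hx, hy⟩
      have h2 : H.dist x v ≤ H.dist x y + H.dist y v := hHc.dist_triangle
      have h3 : H.dist x y = 1 := SimpleGraph.dist_eq_one_iff_adj.2 h1
      show H.dist x v ≤ H.dist y v + 1
      omega
  have hstep : ∀ x, x ≠ v → ∃ y i, x ≠ y ∧ x ∈ B i ∧ y ∈ B i ∧ d x = d y + 1 := by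
    intro x hx
    obtain ⟨p, hp⟩ := hHc.exists_walk_length_eq_dist x v
    cases p with
    | nil => exact absurd rfl hx
    | @cons _ y _ h p =>
      obtain ⟨hne, i, h1, h2⟩ := (hHadj _ _).1 h
      refine ⟨y, i, hne, h1, h2, ?_⟩
      have h3 := hdle i x y h1 h2
      have h4 : H.dist y v ≤ p.length := SimpleGraph.dist_le p
      rw [Walk.length_cons] at hp
      have h5 : d y ≤ p.length := h4
      have h6 : p.length + 1 = d x := hp
      omega
  have main : ∀ n u, d u = n → u ≠ v → ∃ S, R G S u v ∧
      (∀ x ∈ S, ∀ y ∈ S, x ≠ u → x ≠ v → y ≠ u → y ≠ v → γ x = γ y → x = y) ∧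
      ∀ y ∈ S, y ≠ u → ∃ i z, y ∈ B i ∧ z ∈ B i ∧ d z < d u := by
    intro n
    induction n with
    | zero =>
      intro u hu huv
      obtain ⟨y, i, -, -, -, h⟩ := hstep u huv
      omega
    | succ m ih =>
      intro u hu huv
      obtain ⟨x, i0, hux, hui, hxi, hdx⟩ := hstep u huv
      obtain ⟨S0, hS0B, hS0, hS0i⟩ := hf i0 u hui x hxi hux
      have inj0 : ∀ a ∈ S0, ∀ b ∈ S0, a ≠ u → a ≠ x → b ≠ u → b ≠ x → γ a = γ b → a = b := by
        intro a ha b hb h1 h2 h3 h4 hab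
        by_cases hca : G.IsCutVertex a
        · exact hcut a b hca hab
        by_cases hcb : G.IsCutVertex b
        · exact (hcut b a hcb hab.symm).symm
        obtain ⟨i, hai, hbi, hfi⟩ := hnon a b hca hcb hab
        obtain rfl := huniq a i i0 hca hai (hS0B ha)
        exact hS0i a ha b hb h1 h2 h3 h4 hfi
      by_cases hxv : x = v
      · subst hxv
        exact ⟨S0, hS0, inj0, fun y hy _ => ⟨i0, x, hS0B hy, hxi, by omega⟩⟩
      obtain ⟨S', hS', hS'i, hS'd⟩ := ih x (by omega) hxv
      have hxcut : G.IsCutVertex x := by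
        obtain ⟨x2, i1, -, hx1, hx21, hd2⟩ := hstep x hxv
        refine cut_of_two_blocks (hblock i0) (hblock i1) (fun h => ?_) hxi hx1
        obtain rfl := hinj h
        have := hdle i0 u x2 hui hx21
        omega
      refine ⟨S0 ∪ S', (hS0.mono Set.subset_union_left).trans (hS'.mono Set.subset_union_right),
        ?_, ?_⟩
      · have mixed : ∀ a ∈ S0, ∀ b ∈ S', ¬ G.IsCutVertex a → ¬ G.IsCutVertex b → γ a = γ b →
            a = b := by
          intro a ha b hb hca hcb hab
          exfalso
          have hbx : b ≠ x := by rintro rfl; exact hcb hxcut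
          obtain ⟨j, z, hbj, hzj, hdz⟩ := hS'd b hb hbx
          obtain ⟨i, hai, hbi, -⟩ := hnon a b hca hcb hab
          obtain rfl := huniq a i i0 hca hai (hS0B ha)
          obtain rfl := huniq b i j hcb hbi hbj
          have := hdle i u z hui hzj
          omega
        intro a ha b hb h1 h2 h3 h4 hab
        by_cases hca : G.IsCutVertex a
        · exact hcut a b hca hab
        by_cases hcb : G.IsCutVertex b
        · exact (hcut b a hcb hab.symm).symm
        have hax : a ≠ x := by rintro rfl; exact hca hxcut
        have hbx : b ≠ x := by rintro rfl; exact hcb hxcut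
        rcases ha with ha | ha <;> rcases hb with hb | hb
        · exact inj0 a ha b hb h1 hax h3 hbx hab
        · exact mixed a ha b hb hca hcb hab
        · exact (mixed b hb a ha hcb hca hab.symm).symm
        · exact hS'i a ha b hb hax h2 hbx h4 hab
      · rintro y (hy | hy) hyu
        · exact ⟨i0, x, hS0B hy, hxi, by omega⟩
        · by_cases hyx : y = x
          · subst hyx
            exact ⟨i0, y, hxi, hxi, by omega⟩
          · obtain ⟨i, z, h1, h2, h3⟩ := hS'd y hy hyx
            exact ⟨i, z, h1, h2, by omega⟩
  obtain ⟨S, h1, h2, -⟩ := main (d u) u rfl huv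
  exact ⟨S, h1, h2⟩

lemma rainbow_of_R {S : Set V} {u v : V} {c : V → ℕ} (h : R G S u v)
    (hc : ∀ x ∈ S, ∀ y ∈ S, x ≠ u → x ≠ v → y ≠ u → y ≠ v → c x = c y → x = y) :
    ∃ p : G.Walk u v, p.IsRainbowPath c := by
  classical
  obtain ⟨w, hw⟩ := h
  have hpath := w.bypass_isPath
  have hpS : ∀ x ∈ w.bypass.support, x ∈ S :=
    fun x hx => hw x (w.support_bypass_subset_support hx)
  generalize w.bypass = p at hpath hpS
  refine ⟨p, hpath, ?_⟩
  have hnd := hpath.support_nodup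
  have hsub : p.internalVertices.Sublist p.support :=
    (List.dropLast_sublist _).trans (List.tail_sublist _)
  have hu : u ∉ p.internalVertices := by
    intro hmem
    have h1 : u ∈ p.support.tail := (List.dropLast_sublist _).subset hmem
    rw [← Walk.cons_tail_support] at hnd
    exact (List.nodup_cons.1 hnd).1 h1
  have hv : v ∉ p.internalVertices := by
    intro hmem
    have h1 : v ∈ p.support.dropLast := by
      unfold SimpleGraph.Walk.internalVertices at hmem
      rw [← List.tail_dropLast] at hmem
      exact (List.tail_sublist _).subset hmem
    rw [← Walk.dropLast_support_concat] at hnd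
    exact List.disjoint_of_nodup_append hnd h1 (by simp)
  apply List.Nodup.map_on _ (hsub.nodup hnd)
  intro x hx y hy hxy
  refine hc x (hpS x (hsub.subset hx)) y (hpS y (hsub.subset hy)) ?_ ?_ ?_ ?_ hxy
  · rintro rfl; exact hu hx
  · rintro rfl; exact hv hx
  · rintro rfl; exact hu hy
  · rintro rfl; exact hv hy

end combine

end RVC

/-- if the connected graph `G` has block decomposition `B₁, …, B_k` and
exactly `t` cut vertices, then `rvc G ≤ ⌈|B₁|/2⌉ + ⋯ + ⌈|B_k|/2⌉ + t`.
(Here `⌈m/2⌉ = (m + 1) / 2` with natural division.) -/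
theorem rvc_le_sum_ceil_half_blocks_add_cutVertices {V : Type*} [Fintype V]
    (G : SimpleGraph V) (hconn : G.Connected) (k t : ℕ) (B : Fin k → Set V)
    (hblock : ∀ i, G.IsBlock (B i)) (hinj : Function.Injective B)
    (hall : ∀ C : Set V, G.IsBlock C → ∃ i, C = B i)
    (hcut : {v | G.IsCutVertex v}.ncard = t) :
    G.rvc ≤ (∑ i, ((B i).ncard + 1) / 2) + t := by
  classical
  have hN : ∀ i, RVC.Nice G (B i) := fun i => (RVC.isBlock_iff.1 (hblock i)).1
  choose f hf1 hf2 using fun i => RVC.block_coloring (hN i).2.1 (hN i).2.2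
  have hcov : ∀ v, ∃ i, v ∈ B i := by
    intro v
    obtain ⟨C, hC, hb⟩ := RVC.exists_block (RVC.nice_singleton (G := G) v)
    obtain ⟨i, rfl⟩ := hall C hb
    exact ⟨i, hC rfl⟩
  choose β hβ using hcov
  let K := (Σ i : Fin k, Fin (((B i).ncard + 1) / 2)) ⊕ {v | G.IsCutVertex v}
  have hK : Nat.card K = (∑ i, ((B i).ncard + 1) / 2) + t := by
    rw [Nat.card_sum, Nat.card_sigma, Nat.card_coe_set_eq, hcut]
    simp
  let γ : V → K := fun v => if h : G.IsCutVertex v then Sum.inr ⟨v, h⟩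
    else Sum.inl ⟨β v, ⟨f (β v) v, hf1 (β v) v (hβ v)⟩⟩
  have hγ1 : ∀ v (h : G.IsCutVertex v), γ v = Sum.inr ⟨v, h⟩ := fun v h => by simp [γ, h]
  have hγ2 : ∀ v (_ : ¬ G.IsCutVertex v),
      γ v = Sum.inl ⟨β v, ⟨f (β v) v, hf1 (β v) v (hβ v)⟩⟩ := fun v h => by simp [γ, h]
  let e : K ≃ Fin (Nat.card K) := Finite.equivFin K
  apply Nat.sInf_le
  rw [← hK]
  refine ⟨fun v => (e (γ v) : ℕ), fun u v huv => ?_⟩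
  have hc : ∀ x y, (e (γ x) : ℕ) = e (γ y) → γ x = γ y := fun x y h => e.injective (Fin.ext h)
  obtain ⟨S, hS, hSi⟩ := RVC.combine hconn B hblock hinj hall γ f hf2
    (by
      intro x y hx hxy
      rw [hγ1 x hx] at hxy
      by_cases hy : G.IsCutVertex y
      · rw [hγ1 y hy] at hxy
        exact congrArg Subtype.val (Sum.inr.inj hxy)
      · rw [hγ2 y hy] at hxy
        exact absurd hxy (by simp))
    (by
      intro x y hx hy hxy
      rw [hγ2 x hx, hγ2 y hy] at hxy
      have h1 := Sum.inl.inj hxy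
      have h2 : β x = β y := congrArg Sigma.fst h1
      have h3 : f (β x) x = f (β y) y :=
        congrArg (fun s : (Σ i : Fin k, Fin (((B i).ncard + 1) / 2)) => (s.2 : ℕ)) h1
      refine ⟨β x, hβ x, h2 ▸ hβ y, ?_⟩
      rw [h3, h2])
    u v huv
  obtain ⟨p, hp⟩ := RVC.rainbow_of_R (c := fun v => (e (γ v) : ℕ)) hS
    (fun x hx y hy h1 h2 h3 h4 h => hSi x hx y hy h1 h2 h3 h4 (hc x y h))
  exact ⟨p, hp, fun w _ => (e (γ w)).2⟩
end

section
/- If G is a connected graph in which every block is a complete graph and G has exactly t cut vertices, then rvc(G) ≤ t. In particular, the coloring that assigns t pairwise distinct colors to the t cut vertices and one of these colors to all remaining vertices makes G rainbow vertex-connected. -/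
open SimpleGraph in
/-- A walk staying inside `S` gives reachability in the induced graph. -/
theorem aux_reach {V : Type*} {G : SimpleGraph V} {S : Set V} {u v : V} (p : G.Walk u v)
    (hp : ∀ x ∈ p.support, x ∈ S) (hu : u ∈ S) (hv : v ∈ S) :
    (G.induce S).Reachable ⟨u, hu⟩ ⟨v, hv⟩ :=
  ⟨p.induce S hp⟩

open SimpleGraph in
/-- Two neighbours of a non-cut vertex lie in a common block, hence are adjacent. -/
theorem aux_adj {V : Type*} [Fintype V] {G : SimpleGraph V}
    (hcomplete : ∀ B : Set V, G.IsBlock B → ∀ u ∈ B, ∀ v ∈ B, u ≠ v → G.Adj u v)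
    {a w b : V} (haw : G.Adj a w) (hwb : G.Adj w b) (hab : a ≠ b)
    (hw : ¬ G.IsCutVertex w) : G.Adj a b := by
  classical
  unfold SimpleGraph.IsCutVertex at hw
  rw [not_not] at hw
  obtain ⟨q0⟩ := hw ⟨a, haw.ne⟩ ⟨b, hwb.ne'⟩
  obtain ⟨q, hq, hqw⟩ : ∃ q : G.Walk a b, q.IsPath ∧ w ∉ q.support := by
    let q1 : G.Walk a b := q0.map (Embedding.induce {u | u ≠ w}).toHom
    refine ⟨q1.toPath, q1.toPath.2, fun h => ?_⟩
    have h1 : w ∈ (q0.map (Embedding.induce {u | u ≠ w}).toHom).support :=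
      Walk.support_toPath_subset_support q1 h
    rw [Walk.support_map, List.mem_map] at h1
    obtain ⟨⟨y, hy⟩, _, hyw⟩ := h1
    exact hy hyw
  let C : Set V := {x | x = w ∨ x ∈ q.support}
  -- every vertex other than `x` reaches `w` while avoiding `x ≠ w`
  have key : ∀ x, x ≠ w → ∀ y ∈ C, y ≠ x →
      ∃ r : G.Walk y w, ∀ z ∈ r.support, z ∈ C ∧ z ≠ x := by
    intro x hxw y hy hyx
    rcases hy with rfl | hy
    · exact ⟨Walk.nil, by simp [C, hyx]⟩
    by_cases h1 : x ∈ (q.takeUntil y hy).support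
    · have h2 : x ∉ (q.dropUntil y hy).support := by
        intro h2
        have hs := q.take_spec hy
        have hnd := hq.support_nodup
        rw [← hs, Walk.support_append, List.nodup_append] at hnd
        rw [Walk.mem_support_iff] at h2
        rcases h2 with h2 | h2
        · exact hyx h2.symm
        · exact hnd.2.2 x h1 x h2 rfl
      refine ⟨(q.dropUntil y hy).append (Walk.cons hwb.symm Walk.nil), fun z hz => ?_⟩
      rw [Walk.mem_support_append_iff] at hz
      rcases hz with hz | hz
      · exact ⟨Or.inr (q.support_dropUntil_subset_support hy hz), fun h => h2 (h ▸ hz)⟩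
      · simp only [Walk.support_cons, Walk.support_nil, List.mem_cons, List.not_mem_nil,
          or_false] at hz
        rcases hz with rfl | rfl
        · exact ⟨Or.inr q.end_mem_support, fun h => h2 (h ▸ Walk.end_mem_support _)⟩
        · exact ⟨Or.inl rfl, hxw.symm⟩
    · refine ⟨(q.takeUntil y hy).reverse.append (Walk.cons haw Walk.nil), fun z hz => ?_⟩
      rw [Walk.mem_support_append_iff] at hz
      rcases hz with hz | hz
      · rw [Walk.support_reverse, List.mem_reverse] at hz
        exact ⟨Or.inr (q.support_takeUntil_subset_support hy hz), fun h => h1 (h ▸ hz)⟩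
      · simp only [Walk.support_cons, Walk.support_nil, List.mem_cons, List.not_mem_nil,
          or_false] at hz
        rcases hz with rfl | rfl
        · exact ⟨Or.inr q.start_mem_support, fun h => h1 (h ▸ Walk.start_mem_support _)⟩
        · exact ⟨Or.inl rfl, hxw.symm⟩
  have hCconn : (G.induce C).Connected := by
    have hwC : w ∈ C := Or.inl rfl
    have hr : ∀ y : C, (G.induce C).Reachable y ⟨w, hwC⟩ := by
      rintro ⟨y, hy⟩
      rcases hy with rfl | hy'
      · exact Reachable.refl _
      · refine aux_reach ((q.dropUntil y hy').append (Walk.cons hwb.symm Walk.nil)) ?_ _ _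
        intro z hz
        rw [Walk.mem_support_append_iff] at hz
        rcases hz with hz | hz
        · exact Or.inr (q.support_dropUntil_subset_support hy' hz)
        · simp only [Walk.support_cons, Walk.support_nil, List.mem_cons, List.not_mem_nil,
            or_false] at hz
          rcases hz with rfl | rfl
          · exact Or.inr q.end_mem_support
          · exact Or.inl rfl
    have : Nonempty C := ⟨⟨w, hwC⟩⟩
    exact ⟨fun y z => (hr y).trans (hr z).symm⟩
  have hCcut : ∀ v, ¬ (G.induce C).IsCutVertex v := by
    rintro ⟨x, hxC⟩
    unfold SimpleGraph.IsCutVertex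
    rw [not_not]
    have hpre : (G.induce {z | z ∈ C ∧ z ≠ x}).Preconnected := by
      by_cases hxw : x = w
      · subst hxw
        have hr : ∀ y : {z | z ∈ C ∧ z ≠ x}, (G.induce {z | z ∈ C ∧ z ≠ x}).Reachable y
            ⟨b, Or.inr q.end_mem_support, hwb.ne'⟩ := by
          rintro ⟨y, hy, hyx⟩
          have hy' : y ∈ q.support := hy.resolve_left hyx
          refine aux_reach (q.dropUntil y hy') ?_ _ _
          intro z hz
          have := q.support_dropUntil_subset_support hy' hz
          exact ⟨Or.inr this, fun h => hqw (h ▸ this)⟩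
        exact fun y z => (hr y).trans (hr z).symm
      · have hr : ∀ y : {z | z ∈ C ∧ z ≠ x}, (G.induce {z | z ∈ C ∧ z ≠ x}).Reachable y
            ⟨w, Or.inl rfl, Ne.symm hxw⟩ := by
          rintro ⟨y, hy, hyx⟩
          obtain ⟨r, hr⟩ := key x hxw y hy hyx
          exact aux_reach r hr _ _
        exact fun y z => (hr y).trans (hr z).symm
    let f : G.induce {z | z ∈ C ∧ z ≠ x} →g
        (G.induce C).induce {u | u ≠ (⟨x, hxC⟩ : C)} :=
      { toFun := fun z => ⟨⟨z.1, z.2.1⟩, fun h => z.2.2 (congrArg Subtype.val h)⟩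
        map_rel' := fun {_ _} h => h }
    rintro ⟨⟨y, hy⟩, hyx⟩ ⟨⟨z, hz⟩, hzx⟩
    exact (hpre ⟨y, hy, fun h => hyx (Subtype.ext h)⟩
      ⟨z, hz, fun h => hzx (Subtype.ext h)⟩).map f
  obtain ⟨B, hCB, hB⟩ := (Set.toFinite {D : Set V | (G.induce D).Connected ∧
    ∀ v, ¬ (G.induce D).IsCutVertex v}).exists_le_maximal (a := C) ⟨hCconn, hCcut⟩
  refine hcomplete B ⟨hB.prop.1, hB.prop.2, fun D hBD h1 h2 => ?_⟩ a
    (hCB (Or.inr q.start_mem_support)) b (hCB (Or.inr q.end_mem_support)) hab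
  exact (hB.eq_of_le ⟨h1, h2⟩ hBD).symm

open SimpleGraph in
/-- Internal vertices of a shortest walk are cut vertices. -/
theorem aux_internal {V : Type*} [Fintype V] {G : SimpleGraph V}
    (hcomplete : ∀ B : Set V, G.IsBlock B → ∀ u ∈ B, ∀ v ∈ B, u ≠ v → G.Adj u v)
    {u v : V} (p : G.Walk u v) (hp : ∀ q : G.Walk u v, p.length ≤ q.length) :
    ∀ x ∈ p.internalVertices, G.IsCutVertex x := by
  induction p with
  | nil => simp [Walk.internalVertices]
  | @cons u w v h p ih =>
    have hp' : ∀ q : G.Walk w v, p.length ≤ q.length := by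
      intro q
      have := hp (Walk.cons h q)
      simpa using this
    have ih := ih hp'
    cases p with
    | nil => simp [Walk.internalVertices]
    | @cons _ b _ h' p =>
      intro x hx
      have hx' : x = w ∨ x ∈ (Walk.cons h' p).internalVertices := by
        simpa [Walk.internalVertices, List.dropLast_cons_of_ne_nil] using hx
      rcases hx' with rfl | hx'
      · by_contra hcut
        by_cases hub : u = b
        · subst hub
          have := hp p
          simp only [Walk.length_cons] at this
          omega
        · have := hp (Walk.cons (aux_adj hcomplete h h' hub hcut) p)
          simp at this
      · exact ih x hx'

open SimpleGraph in
theorem aux_main {V : Type*} [Fintype V] {G : SimpleGraph V} (hconn : G.Connected)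
    (hcomplete : ∀ B : Set V, G.IsBlock B → ∀ u ∈ B, ∀ v ∈ B, u ≠ v → G.Adj u v)
    (c : V → ℕ) (hc : Set.InjOn c {v | G.IsCutVertex v}) (u v : V) :
    ∃ p : G.Walk u v, p.IsRainbowPath c ∧ ∀ x ∈ p.internalVertices, G.IsCutVertex x := by
  obtain ⟨p, hp, hl⟩ := hconn.exists_path_of_dist u v
  have hi := aux_internal hcomplete p (fun q => hl ▸ dist_le q)
  refine ⟨p, ⟨hp, ?_⟩, hi⟩
  have hnd : p.internalVertices.Nodup :=
    (hp.support_nodup.sublist (List.tail_sublist _)).sublist (List.dropLast_sublist _)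
  exact List.Nodup.map_on (fun x hx y hy h => hc (hi x hx) (hi y hy) h) hnd

/-- if `G` is connected, every block of `G` is complete, and `G` has
exactly `t` cut vertices, then `rvc G ≤ t`; in particular every coloring giving the
`t` cut vertices pairwise distinct colors and all remaining vertices one common color
shared with one of the cut vertices (when cut vertices exist) makes `G` rainbow
vertex-connected. -/
theorem rvc_le_card_cutVertices_of_blocks_complete {V : Type*} [Fintype V]
    (G : SimpleGraph V) (hconn : G.Connected) (t : ℕ)
    (hcomplete : ∀ B : Set V, G.IsBlock B →
      ∀ u ∈ B, ∀ v ∈ B, u ≠ v → G.Adj u v)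
    (hcut : {v | G.IsCutVertex v}.ncard = t) :
    G.rvc ≤ t ∧
    ∀ c : V → ℕ, Set.InjOn c {v | G.IsCutVertex v} →
      (∀ u v : V, ¬ G.IsCutVertex u → ¬ G.IsCutVertex v → c u = c v) →
      ({v | G.IsCutVertex v}.Nonempty →
        ∀ u : V, ¬ G.IsCutVertex u → ∃ w, G.IsCutVertex w ∧ c u = c w) →
      G.RainbowVertexConnected c := by
  classical
  refine ⟨?_, fun c hc _ _ u v _ => ?_⟩
  · apply Nat.sInf_le
    let e := Finite.equivFin {v | G.IsCutVertex v}
    let c : V → ℕ := fun v => if h : G.IsCutVertex v then (e ⟨v, h⟩ : ℕ) else 0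
    have hc : Set.InjOn c {v | G.IsCutVertex v} := by
      intro x hx y hy hxy
      have hx' : G.IsCutVertex x := hx
      have hy' : G.IsCutVertex y := hy
      simp only [c, dif_pos hx', dif_pos hy'] at hxy
      exact congrArg Subtype.val (e.injective (Fin.ext hxy))
    refine ⟨c, fun u v _ => ?_⟩
    obtain ⟨p, hp, hi⟩ := aux_main hconn hcomplete c hc u v
    refine ⟨p, hp, fun x hx => ?_⟩
    simp only [c, dif_pos (hi x hx)]
    rw [← hcut, ← Nat.card_coe_set_eq]
    exact (e ⟨x, hi x hx⟩).2
  · obtain ⟨p, hp, _⟩ := aux_main hconn hcomplete c hc u v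
    exact ⟨p, hp⟩
end
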